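/- arXiv:1312.3215 — 2 statements merged into one kernel-verified Lean document; each statement's English description precedes it below -/
import Mathlib

section
/- Let f : ℕ → ℕ satisfy f(n) = o(n²), and fix r ∈ ℕ. Then there exists n₀ such that for all n ≥ n₀ and all α > 0 with α·C(n,2) − r·n + 1 > f(n), the following holds: if n compact planar sets form a 2-fold packing, each having at most r arc-connected components, the number of intersecting pairs is at least α·C(n,2), and the union of the n sets has at most f(n) holes, then we reach a contradiction; i.e., for fixed α > 0 there are only finitely many n admitting such a configuration. -/
open Set Bornology Classical

noncomputable section

/-- The set of arc-connected (path-connected) components of a planar set. -/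
def pcomps (X : Set (ℝ × ℝ)) : Set (Set (ℝ × ℝ)) :=
  {C | ∃ x ∈ X, C = {y | JoinedIn X x y}}

/-- The set of holes of a planar set: bounded arc-connected components of its complement. -/
def holesSet (X : Set (ℝ × ℝ)) : Set (Set (ℝ × ℝ)) :=
  {C ∈ pcomps Xᶜ | IsBounded C}

/-- A planar set is simply connected if it is arc-connected and has no holes. -/
def SimplyConn (X : Set (ℝ × ℝ)) : Prop :=
  IsPathConnected X ∧ holesSet X = ∅

/-- An interval property that is hereditary, additive and locally true holds on all intervals. -/
theorem interval_induction {P : ℝ → ℝ → Prop}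
    (mono : ∀ {a b a' b'}, a ≤ a' → b' ≤ b → P a b → P a' b')
    (glue : ∀ {a b c}, a ≤ b → b ≤ c → P a b → P b c → P a c)
    (loc : ∀ x, ∃ ε > 0, P (x - ε) (x + ε)) {a b : ℝ} (hab : a ≤ b) : P a b := by
  choose ε hε hP using loc
  obtain ⟨t, ht0, htm, ⟨m, hm⟩, ht⟩ := exists_monotone_Icc_subset_open_cover_Icc hab
    (c := fun x : ℝ => {y : Icc a b | (y : ℝ) ∈ Ioo (x - ε x) (x + ε x)})
    (fun x => isOpen_Ioo.preimage continuous_subtype_val)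
    (fun y _ => mem_iUnion.2 ⟨y, by simp [hε]⟩)
  have key : ∀ n, P (t n) (t (n + 1)) := by
    intro n
    obtain ⟨x, hx⟩ := ht n
    have h1 := hx (left_mem_Icc.2 (htm n.le_succ))
    have h2 := hx (right_mem_Icc.2 (htm n.le_succ))
    exact mono h1.1.le h2.2.le (hP x)
  have all : ∀ n, P a (t n) := by
    intro n
    induction n with
    | zero => rw [ht0]; exact mono (by linarith [hε a]) (by linarith [hε a]) (hP a)
    | succ n ih => exact glue (t n).2.1 (htm n.le_succ) ih (key n)
  have := all m
  rwa [hm m le_rfl] at this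

/-- Integer step functions on the line whose jumps avoid `L`. -/
def stepGroup (L : Set ℝ) : AddSubgroup (ℝ → ℤ) :=
  AddSubgroup.closure
    ({h | ∃ q ∉ L, h = fun x => if q < x then 1 else 0} ∪ {fun _ => 1})

theorem const_mem_stepGroup (L : Set ℝ) (k : ℤ) : (fun _ => k) ∈ stepGroup L := by
  have : (fun _ : ℝ => (1 : ℤ)) ∈ stepGroup L := AddSubgroup.subset_closure (Or.inr rfl)
  convert (stepGroup L).zsmul_mem this k using 1
  ext; simp

theorem jump_mem_stepGroup {L : Set ℝ} {q : ℝ} (hq : q ∉ L) :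
    (fun x => if q < x then 1 else 0) ∈ stepGroup L :=
  AddSubgroup.subset_closure (Or.inl ⟨q, hq, rfl⟩)

theorem comp_max_mem_stepGroup {L : Set ℝ} (b : ℝ) {h : ℝ → ℤ} (hh : h ∈ stepGroup L) :
    (fun x => h (max x b)) ∈ stepGroup L := by
  induction hh using AddSubgroup.closure_induction with
  | mem h hh =>
    rcases hh with ⟨q, hq, rfl⟩ | rfl
    · by_cases hb : q < b
      · convert const_mem_stepGroup L 1 using 1
        ext x; simp [hb]
      · convert jump_mem_stepGroup hq using 1
        ext x; simp [hb]
    · exact const_mem_stepGroup L 1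
  | zero => exact (stepGroup L).zero_mem
  | add f g _ _ hf hg => exact (stepGroup L).add_mem hf hg
  | neg f _ hf => exact (stepGroup L).neg_mem hf

/-- A continuous integer function on a compact piece of `L` extends to a step function with jumps
off `L`. -/
theorem exists_step_eqOn {L : Set ℝ} (hL : IsClosed L) {c d : ℝ} {j : ℝ → ℤ}
    (hj : ContinuousOn j (L ∩ Icc c d)) : ∃ h ∈ stepGroup L, EqOn h j (L ∩ Icc c d) := by
  rcases lt_or_ge d c with hcd | hcd
  · exact ⟨0, zero_mem _, by simp [Icc_eq_empty_of_lt hcd]⟩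
  suffices H : ∃ h ∈ stepGroup L, EqOn h j (L ∩ Icc c d ∩ Icc c d) by
    simpa [inter_assoc] using H
  refine interval_induction (P := fun a b => ∃ h ∈ stepGroup L, EqOn h j (L ∩ Icc c d ∩ Icc a b))
    ?_ ?_ ?_ hcd
  · rintro a b a' b' ha hb ⟨h, hh, he⟩
    exact ⟨h, hh, he.mono (inter_subset_inter_right _ (Icc_subset_Icc ha hb))⟩
  · rintro a b e hab hbe ⟨h₁, hh₁, he₁⟩ ⟨h₂, hh₂, he₂⟩
    have hd := comp_max_mem_stepGroup b ((stepGroup L).sub_mem hh₂ hh₁)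
    by_cases hb : b ∈ L ∩ Icc c d
    · refine ⟨_, (stepGroup L).add_mem hh₁ hd, ?_⟩
      have hb1 := he₁ ⟨hb, hab, le_rfl⟩
      have hb2 := he₂ ⟨hb, le_rfl, hbe⟩
      rintro x ⟨hx, hxa, hxe⟩
      rcases le_total x b with hxb | hxb
      · have := he₁ ⟨hx, hxa, hxb⟩
        simp [*]
      · have := he₂ ⟨hx, hxb, hxe⟩
        simp [*]
    by_cases hbL : b ∈ L
    · rcases lt_or_ge b c with hbc | hbc
      · refine ⟨h₂, hh₂, ?_⟩
        rintro x ⟨hx, hxa, hxe⟩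
        exact he₂ ⟨hx, hbc.le.trans hx.2.1, hxe⟩
      · refine ⟨h₁, hh₁, ?_⟩
        rintro x ⟨hx, hxa, hxe⟩
        have : d < b := by
          by_contra hdb
          exact hb ⟨hbL, hbc, not_lt.1 hdb⟩
        exact he₁ ⟨hx, hxa, hx.2.2.trans this.le⟩
    · refine ⟨_, (stepGroup L).add_mem ((stepGroup L).add_mem hh₁ hd)
        ((stepGroup L).sub_mem ((stepGroup L).zsmul_mem (jump_mem_stepGroup hbL) ((h₂ - h₁) b))
          (const_mem_stepGroup L ((h₂ - h₁) b))), ?_⟩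
      rintro x ⟨hx, hxa, hxe⟩
      rcases lt_trichotomy x b with hxb | rfl | hxb
      · have := he₁ ⟨hx, hxa, hxb.le⟩
        simp [max_eq_right hxb.le, hxb.not_gt, this]
        ring
      · exact absurd hx.1 hbL
      · have := he₂ ⟨hx, hxb.le, hxe⟩
        simp [max_eq_left hxb.le, *]
  · intro x
    have hM : IsClosed (L ∩ Icc c d) := hL.inter isClosed_Icc
    obtain ⟨k, hk⟩ : ∃ k : ℤ, ∀ᶠ y in nhds x, y ∈ L ∩ Icc c d → j y = k := by
      by_cases hx : x ∈ L ∩ Icc c d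
      · refine ⟨j x, eventually_nhdsWithin_iff.1 ?_⟩
        exact (hj x hx).eventually (show ∀ᶠ m in nhds (j x), m = j x by simp)
      · exact ⟨0, (hM.isOpen_compl.eventually_mem hx).mono fun y hy h => absurd h hy⟩
    obtain ⟨ε, hε, hb⟩ := Metric.eventually_nhds_iff.1 hk
    refine ⟨ε / 2, by positivity, fun _ => k, const_mem_stepGroup L k, ?_⟩
    rintro y ⟨hy, hy1, hy2⟩
    refine (hb ?_ hy).symm
    rw [Real.dist_eq, abs_lt]
    constructor <;> linarith

theorem continuousOn_round_re {Y : Type*} [TopologicalSpace Y] {f : Y → ℂ} {S : Set Y}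
    (hf : ContinuousOn f S) (h : ∀ x ∈ S, ∃ k : ℤ, f x = k) :
    ContinuousOn (fun x => round (f x).re) S := by
  refine Int.isClosedEmbedding_coe_real.isInducing.continuousOn_iff.2
    ((Complex.continuous_re.comp_continuousOn hf).congr fun x hx => ?_)
  obtain ⟨k, hk⟩ := h x hx
  simp [hk]

open Complex in
/-- Nonvanishing functions on `K` having a continuous logarithm on `T`. -/
def logGroup {K : Set ℂ} (T : Set K) : Subgroup (K → ℂˣ) where
  carrier := {φ | ∃ g : K → ℂ, ContinuousOn g T ∧ ∀ z ∈ T, (φ z : ℂ) = exp (g z)}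
  one_mem' := ⟨0, continuousOn_const, by simp⟩
  mul_mem' := by
    rintro φ ψ ⟨g, hg, hφ⟩ ⟨h, hh, hψ⟩
    exact ⟨g + h, hg.add hh, fun z hz => by simp [hφ z hz, hψ z hz, exp_add]⟩
  inv_mem' := by
    rintro φ ⟨g, hg, hφ⟩
    exact ⟨-g, hg.neg, fun z hz => by simp [hφ z hz, exp_neg]⟩

theorem logGroup_anti {K : Set ℂ} {S T : Set K} (h : S ⊆ T) : logGroup T ≤ logGroup S :=
  fun _ ⟨g, hg, hφ⟩ => ⟨g, hg.mono h, fun z hz => hφ z (h hz)⟩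

/-- The function `z ↦ z - q` on `K`, for `q ∉ K`. -/
def linFactor {K : Set ℂ} (q : (Kᶜ : Set ℂ)) : K → ℂˣ := fun z =>
  Units.mk0 (z - q) (sub_ne_zero.2 fun h => q.2 (h ▸ z.2))

/-- The group generated by the functions `z ↦ z - q` with `q ∉ K`. -/
def factorGroup (K : Set ℂ) : Subgroup (K → ℂˣ) := Subgroup.closure (range linFactor)

theorem linFactor_mem_factorGroup {K : Set ℂ} (q : (Kᶜ : Set ℂ)) :
    linFactor q ∈ factorGroup K := Subgroup.subset_closure ⟨q, rfl⟩

theorem mul_sub_mem_slitPlane {K : Set ℂ} {u : ℂ} (hu : u ≠ 0) (q : (Kᶜ : Set ℂ)) (z : K)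
    (h : 0 ≤ (u * (z - q)).re) : u * (z - q) ∈ Complex.slitPlane := by
  have h0 : u * (z - q) ≠ 0 := mul_ne_zero hu (sub_ne_zero.2 fun h => q.2 (h ▸ z.2))
  rw [Complex.mem_slitPlane_iff]
  by_contra! hc
  exact h0 (Complex.ext (le_antisymm hc.1 h) hc.2)

theorem exists_log_linFactor {K : Set ℂ} {T : Set K} {u : ℂ} (hu : u ≠ 0) (q : (Kᶜ : Set ℂ))
    (hT : ∀ z ∈ T, 0 ≤ (u * (z - q)).re) {c : ℂ} (hc : Complex.exp c = u⁻¹) :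
    ContinuousOn (fun z : K => Complex.log (u * (z - q)) + c) T ∧
      ∀ z ∈ T, (linFactor q z : ℂ) = Complex.exp (Complex.log (u * (z - q)) + c) := by
  refine ⟨ContinuousOn.add (ContinuousOn.clog (by fun_prop)
    fun z hz => mul_sub_mem_slitPlane hu q z (hT z hz)) continuousOn_const, fun z hz => ?_⟩
  rw [Complex.exp_add, Complex.exp_log
    (Complex.slitPlane_ne_zero (mul_sub_mem_slitPlane hu q z (hT z hz))), hc]
  simp only [linFactor, Units.val_mk0]
  field_simp

theorem linFactor_mem_logGroup {K : Set ℂ} {T : Set K} {u : ℂ} (hu : u ≠ 0) (q : (Kᶜ : Set ℂ))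
    (hT : ∀ z ∈ T, 0 ≤ (u * (z - q)).re) : linFactor q ∈ logGroup T :=
  ⟨_, exists_log_linFactor hu q hT (Complex.exp_log (inv_ne_zero hu))⟩

/-- The part of `K` in a rectangle, in coordinates rotated by `u`. -/
def rect (K : Set ℂ) (u : ℂ) (a b c d : ℝ) : Set K :=
  {z | (u * z).re ∈ Icc a b ∧ (u * z).im ∈ Icc c d}

theorem isClosed_rect (K : Set ℂ) (u : ℂ) (a b c d : ℝ) : IsClosed (rect K u a b c d) :=
  (isClosed_Icc.preimage (f := fun z : K => (u * z).re) (by fun_prop)).inter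
    (isClosed_Icc.preimage (f := fun z : K => (u * z).im) (by fun_prop))

theorem rect_subset {K : Set ℂ} {u : ℂ} {a b c d a' b' c' d' : ℝ} (ha : a' ≤ a) (hb : b ≤ b')
    (hc : c' ≤ c) (hd : d ≤ d') : rect K u a b c d ⊆ rect K u a' b' c' d' :=
  fun _ hz => ⟨Icc_subset_Icc ha hb hz.1, Icc_subset_Icc hc hd hz.2⟩

theorem rect_split (K : Set ℂ) (u : ℂ) (a b c d t : ℝ) :
    rect K u a b c d ⊆ rect K u a t c d ∪ rect K u t b c d := by
  rintro z ⟨⟨h1, h2⟩, h3⟩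
  rcases le_total (u * z).re t with h | h
  · exact Or.inl ⟨⟨h1, h⟩, h3⟩
  · exact Or.inr ⟨⟨h, h2⟩, h3⟩

theorem linFactor_mem_logGroup_or {K : Set ℂ} {u : ℂ} (hu : u ≠ 0) (a b c d t : ℝ)
    (q : (Kᶜ : Set ℂ)) :
    linFactor q ∈ logGroup (rect K u a t c d) ∨ linFactor q ∈ logGroup (rect K u t b c d) := by
  rcases le_total (u * q).re t with h | h
  · refine Or.inr (linFactor_mem_logGroup hu q fun z hz => ?_)
    rw [mul_sub, Complex.sub_re]; linarith [hz.1.1]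
  · refine Or.inl (linFactor_mem_logGroup (neg_ne_zero.2 hu) q fun z hz => ?_)
    rw [mul_sub, Complex.sub_re, neg_mul, neg_mul, Complex.neg_re, Complex.neg_re]
    linarith [hz.1.2]

theorem log_I_mul_sub (y : ℝ) (hy : y ≠ 0) :
    Complex.log (y * Complex.I) - Complex.log (-(y * Complex.I)) + Real.pi * Complex.I =
      2 * Real.pi * Complex.I * (if 0 < y then 1 else 0) := by
  rcases hy.lt_or_gt with h | h
  · have : -((y : ℂ) * Complex.I) = ((-y : ℝ) : ℂ) * Complex.I := by push_cast; ring
    have h2 : (y : ℂ) * Complex.I = ((-y : ℝ) : ℂ) * -Complex.I := by push_cast; ring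
    rw [this, h2, Complex.log_ofReal_mul (neg_pos.2 h) Complex.I_ne_zero,
      Complex.log_ofReal_mul (neg_pos.2 h) (neg_ne_zero.2 Complex.I_ne_zero), Complex.log_I,
      Complex.log_neg_I, if_neg h.not_gt]
    ring
  · have h2 : -((y : ℂ) * Complex.I) = y * -Complex.I := by ring
    rw [h2, Complex.log_ofReal_mul h Complex.I_ne_zero,
      Complex.log_ofReal_mul h (neg_ne_zero.2 Complex.I_ne_zero), Complex.log_I,
      Complex.log_neg_I, if_pos h]
    ring

/-- Every step function along the line `Re (u z) = t` with jumps off `K` is the discrepancy of the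
logarithms, on both sides of the line, of a product of linear factors. -/
theorem exists_factor_of_step {K : Set ℂ} {u : ℂ} (hu : u ≠ 0) (a b c d t : ℝ) {h : ℝ → ℤ}
    (hh : h ∈ stepGroup {x : ℝ | u⁻¹ * (t + x * Complex.I) ∈ K}) :
    ∃ ψ ∈ factorGroup K, ∃ s₁ s₂ : K → ℂ,
      (ContinuousOn s₁ (rect K u a t c d) ∧
        ∀ z ∈ rect K u a t c d, (ψ z : ℂ) = Complex.exp (s₁ z)) ∧
      (ContinuousOn s₂ (rect K u t b c d) ∧
        ∀ z ∈ rect K u t b c d, (ψ z : ℂ) = Complex.exp (s₂ z)) ∧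
      ∀ z : K, (u * z).re = t → s₁ z - s₂ z = 2 * Real.pi * Complex.I * h (u * z).im := by
  induction hh using AddSubgroup.closure_induction with
  | mem h hh =>
    rcases hh with ⟨x, hx, rfl⟩ | rfl
    · let q : (Kᶜ : Set ℂ) := ⟨u⁻¹ * (t + x * Complex.I), hx⟩
      have huq : u * (q : ℂ) = t + x * Complex.I := mul_inv_cancel_left₀ hu _
      let c₂ := Complex.log u⁻¹
      have hc₂ : Complex.exp c₂ = u⁻¹ := Complex.exp_log (inv_ne_zero hu)
      have hc₁ : Complex.exp (c₂ - Real.pi * Complex.I) = (-u)⁻¹ := by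
        rw [Complex.exp_sub, hc₂, Complex.exp_pi_mul_I, inv_neg]; ring
      obtain ⟨C1, E1⟩ := exists_log_linFactor (T := rect K u a t c d) (neg_ne_zero.2 hu) q
        (fun z hz => by
          rw [neg_mul, mul_sub, huq]; simp only [Complex.neg_re, Complex.sub_re, Complex.add_re]
          simpa using hz.1.2) hc₁
      obtain ⟨C2, E2⟩ := exists_log_linFactor (T := rect K u t b c d) hu q
        (fun z hz => by
          rw [mul_sub, huq]; simp only [Complex.sub_re, Complex.add_re]
          simpa using hz.1.1) hc₂
      refine ⟨_, (factorGroup K).inv_mem (linFactor_mem_factorGroup q), _, _,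
        ⟨C1.neg, fun z hz => ?_⟩, ⟨C2.neg, fun z hz => ?_⟩, fun z hz => ?_⟩
      · rw [Pi.inv_apply, Units.val_inv_eq_inv_val, E1 z hz, ← Complex.exp_neg]; rfl
      · rw [Pi.inv_apply, Units.val_inv_eq_inv_val, E2 z hz, ← Complex.exp_neg]; rfl
      · have hw : u * ((z : ℂ) - q) = (((u * z).im - x : ℝ) : ℂ) * Complex.I := by
          rw [mul_sub, huq]
          apply Complex.ext <;> simp [← hz]
        have hy : (u * (z : ℂ)).im - x ≠ 0 := by
          intro h0
          rw [h0] at hw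
          simp [hu, sub_eq_zero] at hw
          exact q.2 (hw ▸ z.2)
        have := log_I_mul_sub _ hy
        simp only [Pi.neg_apply, neg_mul, hw, sub_pos] at this ⊢
        push_cast at this ⊢
        rw [← this]; ring
    · exact ⟨1, one_mem _, fun _ => 2 * Real.pi * Complex.I, fun _ => 0,
        ⟨continuousOn_const, by simp⟩, ⟨continuousOn_const, by simp⟩, by simp⟩
  | zero => exact ⟨1, one_mem _, 0, 0, ⟨continuousOn_const, by simp⟩,
      ⟨continuousOn_const, by simp⟩, by simp⟩
  | add f g _ _ hf hg =>
    obtain ⟨ψ, hψ, s₁, s₂, ⟨a1, a2⟩, ⟨a3, a4⟩, a5⟩ := hf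
    obtain ⟨ψ', hψ', s₁', s₂', ⟨b1, b2⟩, ⟨b3, b4⟩, b5⟩ := hg
    refine ⟨_, mul_mem hψ hψ', s₁ + s₁', s₂ + s₂', ⟨a1.add b1, fun z hz => ?_⟩,
      ⟨a3.add b3, fun z hz => ?_⟩, fun z hz => ?_⟩
    · simp [a2 z hz, b2 z hz, Complex.exp_add]
    · simp [a4 z hz, b4 z hz, Complex.exp_add]
    · have h1 := a5 z hz
      have h2 := b5 z hz
      simp only [Pi.add_apply]; push_cast
      linear_combination h1 + h2
  | neg f _ hf =>
    obtain ⟨ψ, hψ, s₁, s₂, ⟨a1, a2⟩, ⟨a3, a4⟩, a5⟩ := hf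
    refine ⟨_, inv_mem hψ, -s₁, -s₂, ⟨a1.neg, fun z hz => ?_⟩,
      ⟨a3.neg, fun z hz => ?_⟩, fun z hz => ?_⟩
    · simp [a2 z hz, Complex.exp_neg]
    · simp [a4 z hz, Complex.exp_neg]
    · have h1 := a5 z hz
      simp only [Pi.neg_apply]; push_cast
      linear_combination -h1

theorem mem_logGroup_union {K : Set ℂ} {S T : Set K} (hS : IsClosed S) (hT : IsClosed T)
    {φ : K → ℂˣ} {g₁ g₂ : K → ℂ} (h₁ : ContinuousOn g₁ S) (h₂ : ContinuousOn g₂ T)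
    (e₁ : ∀ z ∈ S, (φ z : ℂ) = Complex.exp (g₁ z)) (e₂ : ∀ z ∈ T, (φ z : ℂ) = Complex.exp (g₂ z))
    (he : ∀ z ∈ S ∩ T, g₁ z = g₂ z) : φ ∈ logGroup (S ∪ T) := by
  have f₁ : EqOn (S.piecewise g₁ g₂) g₁ S := piecewise_eqOn _ _ _
  have f₂ : EqOn (S.piecewise g₁ g₂) g₂ T := by
    intro z hz
    by_cases hzS : z ∈ S
    · simp [hzS, he z ⟨hzS, hz⟩]
    · simp [hzS]
  refine ⟨S.piecewise g₁ g₂, (h₁.congr f₁).union_of_isClosed (h₂.congr f₂) hS hT, ?_⟩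
  rintro z (hz | hz)
  · rw [f₁ hz, e₁ z hz]
  · rw [f₂ hz, e₂ z hz]

theorem mem_of_mem_both {K : Set ℂ} (hK : IsClosed K) {u : ℂ} (hu : u ≠ 0) {a b c d t : ℝ}
    {φ : K → ℂˣ} (h₁ : φ ∈ logGroup (rect K u a t c d)) (h₂ : φ ∈ logGroup (rect K u t b c d)) :
    φ ∈ logGroup (rect K u a t c d ∪ rect K u t b c d) ⊔ factorGroup K := by
  obtain ⟨g₁, C1, E1⟩ := h₁
  obtain ⟨g₂, C2, E2⟩ := h₂
  let γ : ℝ → ℂ := fun x => u⁻¹ * (t + x * Complex.I)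
  have hγ : Continuous γ := by fun_prop
  have huγ : ∀ x, u * γ x = t + x * Complex.I := fun x => mul_inv_cancel_left₀ hu _
  have hγz : ∀ z : K, (u * z).re = t → γ (u * z).im = z := by
    intro z hz
    simp only [γ, ← hz, Complex.re_add_im]
    exact inv_mul_cancel_left₀ hu _
  let L : Set ℝ := {x | γ x ∈ K}
  have hL : IsClosed L := hK.preimage hγ
  have key : ∀ z ∈ rect K u a t c d ∩ rect K u t b c d,
      ∃ k : ℤ, g₁ z - g₂ z = 2 * Real.pi * Complex.I * k := by
    rintro z ⟨h1, h2⟩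
    obtain ⟨k, hk⟩ := Complex.exp_eq_exp_iff_exists_int.1 ((E1 z h1).symm.trans (E2 z h2))
    exact ⟨k, by rw [hk]; ring⟩
  by_cases hat : a ≤ t ∧ t ≤ b
  swap
  · refine Subgroup.mem_sup_left (mem_logGroup_union (isClosed_rect ..) (isClosed_rect ..)
      C1 C2 E1 E2 ?_)
    rintro z ⟨h1, h2⟩
    exact absurd ⟨h1.1.1.trans h1.1.2, h2.1.1.trans h2.1.2⟩ hat
  have hmem : ∀ x (hx : x ∈ L), x ∈ Icc c d →
      (⟨γ x, hx⟩ : K) ∈ rect K u a t c d ∩ rect K u t b c d := by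
    intro x hx hxc
    simp only [rect, mem_inter_iff, mem_ofPred_eq, huγ]
    simpa [hat.1, hat.2] using hxc
  let F : ℝ → ℂ := fun x => if hx : x ∈ L then
    (g₁ ⟨γ x, hx⟩ - g₂ ⟨γ x, hx⟩) / (2 * Real.pi * Complex.I) else 0
  have hpi : (2 * Real.pi * Complex.I : ℂ) ≠ 0 := Complex.two_pi_I_ne_zero
  have hF : ∀ x ∈ L ∩ Icc c d, ∃ k : ℤ, F x = k := by
    rintro x ⟨hx, hxc⟩
    obtain ⟨k, hk⟩ := key _ (hmem x hx hxc)
    exact ⟨k, by simp only [F, dif_pos hx, hk]; field_simp⟩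
  have hFc : ContinuousOn F (L ∩ Icc c d) := by
    rw [continuousOn_iff_continuous_domRestrict]
    have hc : Continuous fun x : (L ∩ Icc c d : Set ℝ) =>
        (⟨⟨γ x, x.2.1⟩, hmem x x.2.1 x.2.2⟩ : (rect K u a t c d ∩ rect K u t b c d : Set K)) := by
      fun_prop
    have h3 := ((C1.mono inter_subset_left).sub (C2.mono inter_subset_right)).domRestrict.comp hc
    convert h3.div_const (2 * Real.pi * Complex.I) using 1
    ext x
    have : (x : ℝ) ∈ L := x.2.1
    simp [F, this]
  let j : ℝ → ℤ := fun x => round (F x).re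
  have hj : ∀ x ∈ L ∩ Icc c d, F x = j x := by
    intro x hx
    obtain ⟨k, hk⟩ := hF x hx
    simp [j, hk]
  obtain ⟨h, hh, he⟩ := exists_step_eqOn hL (continuousOn_round_re hFc hF)
  obtain ⟨ψ, hψ, s₁, s₂, ⟨a1, a2⟩, ⟨a3, a4⟩, a5⟩ := exists_factor_of_step hu a b c d t hh
  have : φ * ψ⁻¹ ∈ logGroup (rect K u a t c d ∪ rect K u t b c d) := by
    refine mem_logGroup_union (isClosed_rect ..) (isClosed_rect ..) (C1.sub a1) (C2.sub a3)
      (fun z hz => ?_) (fun z hz => ?_) ?_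
    · simp [E1 z hz, a2 z hz, Complex.exp_sub, div_eq_mul_inv]
    · simp [E2 z hz, a4 z hz, Complex.exp_sub, div_eq_mul_inv]
    · rintro z ⟨h1, h2⟩
      have hz : (u * z).re = t := le_antisymm h1.1.2 h2.1.1
      have hzL : (u * z).im ∈ L := by
        change γ _ ∈ K
        rw [hγz z hz]; exact z.2
      have h5 := a5 z hz
      rw [he ⟨hzL, h1.2⟩, ← hj _ ⟨hzL, h1.2⟩] at h5
      have hz' : (⟨γ (u * z).im, hzL⟩ : K) = z := Subtype.ext (hγz z hz)
      simp only [F, dif_pos hzL, hz', mul_div_cancel₀ _ hpi] at h5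
      simp only [Pi.sub_apply]
      linear_combination -h5
  rw [show φ = φ * ψ⁻¹ * ψ by simp]
  exact Subgroup.mul_mem_sup this hψ

theorem mem_sup_glue {K : Set ℂ} (hK : IsClosed K) {u : ℂ} (hu : u ≠ 0) {a b c d t : ℝ}
    {φ : K → ℂˣ} (h₁ : φ ∈ logGroup (rect K u a t c d) ⊔ factorGroup K)
    (h₂ : φ ∈ logGroup (rect K u t b c d) ⊔ factorGroup K) :
    φ ∈ logGroup (rect K u a b c d) ⊔ factorGroup K := by
  refine (sup_le_sup_right (logGroup_anti (rect_split K u a b c d t)) _) ?_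
  have hsplit : factorGroup K ≤ (logGroup (rect K u a t c d) ⊓ factorGroup K) ⊔
      (logGroup (rect K u t b c d) ⊓ factorGroup K) := by
    refine (Subgroup.closure_le _).2 ?_
    rintro _ ⟨q, rfl⟩
    rcases linFactor_mem_logGroup_or hu a b c d t q with h | h
    · exact Subgroup.mem_sup_left ⟨h, linFactor_mem_factorGroup q⟩
    · exact Subgroup.mem_sup_right ⟨h, linFactor_mem_factorGroup q⟩
  obtain ⟨e₁, he₁, r₁, hr₁, rfl⟩ := Subgroup.mem_sup.1 h₁
  obtain ⟨e₂, he₂, r₂, hr₂, hφ⟩ := Subgroup.mem_sup.1 h₂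
  obtain ⟨s₁, hs₁, s₂, hs₂, hs⟩ := Subgroup.mem_sup.1 (hsplit (mul_mem (inv_mem hr₁) hr₂))
  have hx : e₁ * s₁⁻¹ = e₂ * s₂ := by
    have h3 : r₂ = r₁ * (s₁ * s₂) := by rw [hs]; group
    rw [h3] at hφ
    rw [mul_inv_eq_iff_eq_mul]
    apply mul_right_cancel (b := r₁)
    rw [← hφ]
    simp only [mul_comm, mul_left_comm]
  have h4 := mem_of_mem_both hK hu (a := a) (b := b) (c := c) (d := d) (t := t)
    (φ := e₁ * s₁⁻¹) (mul_mem he₁ (inv_mem hs₁.1)) (hx ▸ mul_mem he₂ hs₂.1)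
  have h5 : e₁ * r₁ = e₁ * s₁⁻¹ * (s₁ * r₁) := by simp [mul_assoc]
  rw [h5]
  exact mul_mem h4 (Subgroup.mem_sup_right (mul_mem hs₁.2 hr₁))

theorem rect_rotate (K : Set ℂ) (a b c d : ℝ) :
    rect K Complex.I (-d) (-c) a b = rect K 1 a b c d := by
  ext z
  simp only [rect, mem_ofPred_eq, mem_Icc]
  simp
  tauto

theorem exists_nhds_mem_logGroup {K : Set ℂ} (hK : IsClosed K) {φ : K → ℂˣ}
    (hφ : Continuous fun z => (φ z : ℂ)) (p : ℂ) :
    ∃ W ∈ nhds p, φ ∈ logGroup {z : K | (z : ℂ) ∈ W} := by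
  by_cases hp : p ∈ K
  · let f : K → ℂ := fun z => φ z / φ ⟨p, hp⟩
    have hf : Continuous f := hφ.div_const _
    have h1 : f ⁻¹' Complex.slitPlane ∈ nhds (⟨p, hp⟩ : K) :=
      hf.continuousAt.preimage_mem_nhds (Complex.isOpen_slitPlane.mem_nhds (by simp [f]))
    rw [nhds_subtype, Filter.mem_comap] at h1
    obtain ⟨W, hW, hWs⟩ := h1
    refine ⟨W, hW, fun z => Complex.log (f z) + Complex.log (φ ⟨p, hp⟩), ?_, fun z hz => ?_⟩
    · exact (hf.continuousOn.clog fun z hz => hWs hz).add continuousOn_const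
    · rw [Complex.exp_add, Complex.exp_log (Complex.slitPlane_ne_zero (hWs hz)),
        Complex.exp_log (Units.ne_zero _)]
      simp [f]
  · refine ⟨Kᶜ, hK.isOpen_compl.mem_nhds hp, 0, continuousOn_const, ?_⟩
    intro z hz
    exact absurd z.2 hz

theorem exists_rect_mem_logGroup {K : Set ℂ} (hK : IsClosed K) {φ : K → ℂˣ}
    (hφ : Continuous fun z => (φ z : ℂ)) (x y : ℝ) :
    ∃ ε > 0, φ ∈ logGroup (rect K 1 (x - ε) (x + ε) (y - ε) (y + ε)) := by
  obtain ⟨W, hW, hφW⟩ := exists_nhds_mem_logGroup hK hφ ⟨x, y⟩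
  obtain ⟨ε, hε, hb⟩ := Metric.mem_nhds_iff.1 hW
  refine ⟨ε / 3, by positivity, logGroup_anti ?_ hφW⟩
  rintro z ⟨⟨h1, h2⟩, h3, h4⟩
  rw [one_mul] at h1 h2 h3 h4
  refine hb ?_
  rw [Metric.mem_ball, dist_eq_norm]
  refine (Complex.norm_le_abs_re_add_abs_im _).trans_lt ?_
  have h5 : |((z : ℂ) - ⟨x, y⟩).re| ≤ ε / 3 := by
    rw [abs_le]; constructor <;> simp <;> linarith
  have h6 : |((z : ℂ) - ⟨x, y⟩).im| ≤ ε / 3 := by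
    rw [abs_le]; constructor <;> simp <;> linarith
  linarith

/-- On a planar compact set every nonvanishing continuous function is, up to a function with a
continuous logarithm, a product of linear factors. -/
theorem continuous_mem_sup {K : Set ℂ} (hK : IsCompact K) {φ : K → ℂˣ}
    (hφ : Continuous fun z => (φ z : ℂ)) : φ ∈ logGroup univ ⊔ factorGroup K := by
  have hcl := hK.isClosed
  obtain ⟨R, hR0, hR⟩ := hK.isBounded.exists_pos_norm_le
  have huniv : (univ : Set K) ⊆ rect K 1 (-R) R (-R) R := by
    intro z _
    have h1 := (Complex.abs_re_le_norm z).trans (hR z z.2)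
    have h2 := (Complex.abs_im_le_norm z).trans (hR z z.2)
    simpa [rect, abs_le] using And.intro (abs_le.1 h1) (abs_le.1 h2)
  refine sup_le_sup_right (logGroup_anti huniv) _ ?_
  have mono : ∀ {a b c d a' b' c' d' : ℝ}, a' ≤ a → b ≤ b' → c' ≤ c → d ≤ d' →
      φ ∈ logGroup (rect K 1 a' b' c' d') ⊔ factorGroup K →
      φ ∈ logGroup (rect K 1 a b c d) ⊔ factorGroup K := fun ha hb hc hd h =>
    sup_le_sup_right (logGroup_anti (rect_subset ha hb hc hd)) _ h
  refine interval_induction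
    (P := fun a b => φ ∈ logGroup (rect K 1 a b (-R) R) ⊔ factorGroup K)
    (fun ha hb h => mono ha hb le_rfl le_rfl h)
    (fun _ _ h h' => mem_sup_glue hcl one_ne_zero h h') (fun x => ?_) (by linarith)
  refine interval_induction
    (P := fun c d => ∃ ε > 0, φ ∈ logGroup (rect K 1 (x - ε) (x + ε) c d) ⊔ factorGroup K)
    (fun ha hb ⟨ε, hε, h⟩ => ⟨ε, hε, mono le_rfl le_rfl ha hb h⟩)
    ?_ (fun y => ?_) (by linarith)
  · rintro a b c - - ⟨ε, hε, h⟩ ⟨ε', hε', h'⟩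
    have l1 := min_le_left ε ε'
    have l2 := min_le_right ε ε'
    refine ⟨min ε ε', lt_min hε hε', ?_⟩
    replace h := mono (a := x - min ε ε') (b := x + min ε ε') (by linarith) (by linarith)
      le_rfl le_rfl h
    replace h' := mono (a := x - min ε ε') (b := x + min ε ε') (by linarith) (by linarith)
      le_rfl le_rfl h'
    rw [← rect_rotate] at h h' ⊢
    exact mem_sup_glue hcl Complex.I_ne_zero h' h
  · obtain ⟨ε, hε, h⟩ := exists_rect_mem_logGroup hcl hφ x y
    exact ⟨ε, hε, ε, hε, Subgroup.mem_sup_left h⟩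

/-- Nonvanishing functions on `K` modulo those having a continuous logarithm. -/
def logClass (K : Set ℂ) : Type := (K → ℂˣ) ⧸ logGroup (univ : Set K)

instance (K : Set ℂ) : CommGroup (logClass K) :=
  QuotientGroup.Quotient.commGroup (logGroup (univ : Set K))

/-- The class of a nonvanishing function. -/
def toLogClass (K : Set ℂ) : (K → ℂˣ) →* logClass K := QuotientGroup.mk' _

theorem toLogClass_eq_one {K : Set ℂ} {φ : K → ℂˣ} :
    toLogClass K φ = 1 ↔ φ ∈ logGroup (univ : Set K) := QuotientGroup.eq_one_iff φ

theorem toLogClass_eq {K : Set ℂ} {φ ψ : K → ℂˣ} :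
    toLogClass K φ = toLogClass K ψ ↔ φ⁻¹ * ψ ∈ logGroup (univ : Set K) := QuotientGroup.eq

theorem isLocallyConstant_linFactor {K : Set ℂ} (hK : IsCompact K) :
    IsLocallyConstant fun q : (Kᶜ : Set ℂ) => toLogClass K (linFactor q) := by
  refine (IsLocallyConstant.iff_eventually_eq _).2 fun q => ?_
  obtain ⟨ε, hε, hb⟩ := Metric.isOpen_iff.1 hK.isClosed.isOpen_compl q q.2
  filter_upwards [Metric.ball_mem_nhds q hε] with q' hq'
  refine toLogClass_eq.2 ⟨fun z => -Complex.log (1 + (q - q') / (z - q)), ?_, fun z _ => ?_⟩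
  all_goals
    have hs : ∀ z : K, 1 + ((q : ℂ) - q') / (z - q) ∈ Complex.slitPlane := by
      intro z
      refine Complex.mem_slitPlane_of_norm_lt_one ?_
      have hz : (z : ℂ) ∉ Metric.ball (q : ℂ) ε := fun h => hb h z.2
      rw [Metric.mem_ball, not_lt, dist_eq_norm] at hz
      rw [norm_div, div_lt_one (hε.trans_le hz)]
      have : dist (q' : ℂ) q < ε := hq'
      rw [dist_comm, dist_eq_norm] at this
      exact this.trans_le hz
    have hne : ∀ z : K, (z : ℂ) - q ≠ 0 := fun z => sub_ne_zero.2 fun h => q.2 (h ▸ z.2)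
  · have hc : Continuous fun z : K => 1 + ((q : ℂ) - q') / (z - q) :=
      continuous_const.add (continuous_const.div (by fun_prop) hne)
    exact (hc.continuousOn.clog fun z _ => hs z).neg
  · have hne' : (z : ℂ) - q' ≠ 0 := sub_ne_zero.2 fun h => q'.2 (h ▸ z.2)
    rw [Complex.exp_neg, Complex.exp_log (Complex.slitPlane_ne_zero (hs z))]
    have h1 : 1 + ((q : ℂ) - q') / (z - q) = (z - q') / (z - q) := by
      field_simp [hne z]; ring
    rw [h1]
    simp [linFactor, div_eq_mul_inv, mul_comm]

theorem linFactor_eq_of_joined {K : Set ℂ} (hK : IsCompact K) {q q' : (Kᶜ : Set ℂ)}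
    (h : Joined q q') : toLogClass K (linFactor q) = toLogClass K (linFactor q') := by
  obtain ⟨γ⟩ := h
  exact (isLocallyConstant_linFactor hK).apply_eq_of_isPreconnected
    (isPreconnected_range γ.continuous) ⟨0, γ.source⟩ ⟨1, γ.target⟩

theorem linFactor_eq_one_of_far {K : Set ℂ} {R : ℝ} (hR : ∀ z ∈ K, ‖z‖ ≤ R)
    {q : (Kᶜ : Set ℂ)} (hq : R < ‖(q : ℂ)‖) : toLogClass K (linFactor q) = 1 := by
  rcases K.eq_empty_or_nonempty with rfl | ⟨w, hw⟩
  · exact congrArg _ (Subsingleton.elim _ _)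
  have hq0 : (q : ℂ) ≠ 0 := norm_pos_iff.1 (((norm_nonneg w).trans (hR w hw)).trans_lt hq)
  refine toLogClass_eq_one.2 (linFactor_mem_logGroup (u := -(q : ℂ)⁻¹)
    (neg_ne_zero.2 (inv_ne_zero hq0)) q fun z _ => ?_)
  have h1 : -(q : ℂ)⁻¹ * (z - q) = 1 - z / q := by field_simp; ring
  have h2 : ‖(z : ℂ) / q‖ ≤ 1 := by
    rw [norm_div]
    exact div_le_one_of_le₀ ((hR z z.2).trans hq.le) (norm_nonneg _)
  rw [h1, Complex.sub_re, Complex.one_re]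
  linarith [(Complex.abs_re_le_norm ((z : ℂ) / q)).trans h2, le_abs_self ((z : ℂ) / q).re]

theorem card_le_of_ker_le_range {M ι J : Type*} [AddCommGroup M] [Fintype ι] [Fintype J]
    {F : Set M} (hF : F.Finite) (v : ι → M) (hv : ∀ i, v i ∈ Submodule.span ℤ F)
    (D : (J → ℤ) →ₗ[ℤ] (ι → ℤ))
    (hD : LinearMap.ker (Fintype.linearCombination ℤ v) ≤ LinearMap.range D) :
    Fintype.card ι ≤ F.ncard + Fintype.card J := by
  have h1 := Submodule.finrank_quotient_add_finrank
    (LinearMap.ker (Fintype.linearCombination ℤ v))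
  rw [(Fintype.linearCombination ℤ v).quotKerEquivRange.finrank_eq] at h1
  have h2 : Module.finrank ℤ (LinearMap.range (Fintype.linearCombination ℤ v)) ≤ F.ncard := by
    have := hF.to_subtype
    have := hF.fintype
    have : Module.Finite ℤ (Submodule.span ℤ F) := Module.Finite.span_of_finite ℤ hF
    refine (Submodule.finrank_mono (t := Submodule.span ℤ F) ?_).trans ?_
    · rw [Fintype.range_linearCombination]
      exact Submodule.span_le.2 (range_subset_iff.2 hv)
    · rw [Set.ncard_eq_toFinset_card' F]
      exact finrank_span_le_card F
  have h3 : Module.finrank ℤ (LinearMap.ker (Fintype.linearCombination ℤ v)) ≤ Fintype.card J := by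
    refine (Submodule.finrank_mono hD).trans ?_
    have := LinearMap.finrank_range_le D
    rwa [Module.finrank_fintype_fun_eq_card] at this
  rw [Module.finrank_fintype_fun_eq_card] at h1
  omega

theorem exists_bump {n : ℕ} {X : Fin n → Set ℂ} (hX : ∀ i, IsClosed (X i))
    (h2 : ∀ i j k : Fin n, i ≠ j → j ≠ k → i ≠ k → X i ∩ X j ∩ X k = ∅) {i j : Fin n}
    (hij : i ≠ j) : ∃ h : ℂ → ℝ, Continuous h ∧ (∀ z ∈ X i, z ∈ X j → h z = 1) ∧
      ∀ l, l ≠ i → l ≠ j → ∀ z ∈ X i, z ∈ X l → h z = 0 := by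
  have hs : IsClosed (⋃ l : {l : Fin n // l ≠ i ∧ l ≠ j}, X i ∩ X l) :=
    isClosed_iUnion_of_finite fun l => (hX i).inter (hX l)
  obtain ⟨h, h0, h1, -⟩ := exists_continuous_zero_one_of_isClosed hs ((hX i).inter (hX j)) (by
    rw [Set.disjoint_left]
    rintro z hz ⟨hzi, hzj⟩
    obtain ⟨⟨l, hli, hlj⟩, -, hzl⟩ := mem_iUnion.1 hz
    have : z ∈ X i ∩ X j ∩ X l := ⟨⟨hzi, hzj⟩, hzl⟩
    rwa [h2 i j l hij hlj.symm hli.symm] at this)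
  exact ⟨h, h.continuous, fun z hi hj => h1 ⟨hi, hj⟩,
    fun l hli hlj z hi hl => h0 (mem_iUnion.2 ⟨⟨l, hli, hlj⟩, hi, hl⟩)⟩

/-- The intersecting pairs of a 2-fold packing number at most the rank of the classes of linear
factors of the union plus the total number of components. -/
theorem card_intersecting_le {n : ℕ} {X : Fin n → Set ℂ} (hX : ∀ i, IsCompact (X i))
    (h2 : ∀ i j k : Fin n, i ≠ j → j ≠ k → i ≠ k → X i ∩ X j ∩ X k = ∅)
    {J : Fin n → Type*} [∀ i, Fintype (J i)] (κ : ∀ i, X i → J i)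
    (hκ : ∀ i x y, κ i x = κ i y → ∃ S ⊆ X i, IsPreconnected S ∧ (x : ℂ) ∈ S ∧ (y : ℂ) ∈ S)
    {K : Set ℂ} (hXK : K = ⋃ i, X i) {F : Set (logClass K)} (hF : F.Finite)
    (hfac : ∀ q : (Kᶜ : Set ℂ), toLogClass K (linFactor q) ∈ Subgroup.closure F) :
    Fintype.card {p : Fin n × Fin n // p.1 < p.2 ∧ (X p.1 ∩ X p.2).Nonempty} ≤
      F.ncard + ∑ i, Fintype.card (J i) := by
  let ι := {p : Fin n × Fin n // p.1 < p.2 ∧ (X p.1 ∩ X p.2).Nonempty}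
  have hK : IsCompact K := hXK ▸ isCompact_iUnion hX
  have hc : ∀ i, IsClosed (X i) := fun i => (hX i).isClosed
  choose h hcont hone hzero using fun e : ι => exists_bump hc h2 e.2.1.ne
  choose x hxl hxr using fun e : ι => e.2.2
  let f : ι → ℂ → ℝ := fun e z => if z ∈ X e.1.1 then h e z else 0
  have hfint : ∀ e i z, z ∈ X i → i ≠ e.1.1 → ∃ k : ℤ, f e z = k := by
    intro e i z hz hi
    by_cases hze : z ∈ X e.1.1
    · by_cases hie : i = e.1.2
      · exact ⟨1, by simp [f, hze, hone e z hze (hie ▸ hz)]⟩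
      · exact ⟨0, by simp [f, hze, hzero e i hi hie z hze hz]⟩
    · exact ⟨0, by simp [f, hze]⟩
  have hexp : ∀ k : ℤ, Complex.exp (2 * Real.pi * Complex.I * (k : ℝ)) = 1 := fun k =>
    Complex.exp_eq_one_iff.2 ⟨k, by push_cast; ring⟩
  let φ : ι → K → ℂˣ := fun e z =>
    Units.mk0 (Complex.exp (2 * Real.pi * Complex.I * f e z)) (Complex.exp_ne_zero _)
  have hφ : ∀ e, Continuous fun z => (φ e z : ℂ) := by
    intro e
    refine (locallyFinite_of_finite fun i : Fin n => {z : K | (z : ℂ) ∈ X i}).continuous ?_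
      (fun i => (hc i).preimage continuous_subtype_val) (fun i => ?_)
    · refine eq_univ_of_forall fun z => ?_
      obtain ⟨i, hi⟩ := mem_iUnion.1 (hXK.subset z.2)
      exact mem_iUnion.2 ⟨i, hi⟩
    · by_cases hi : i = e.1.1
      · subst hi
        refine ContinuousOn.congr (f := fun z : K =>
          Complex.exp (2 * Real.pi * Complex.I * h e z)) ?_ fun z hz => ?_
        · have := hcont e
          fun_prop
        · have : (z : ℂ) ∈ X e.1.1 := hz
          simp [φ, f, this]
      · refine continuousOn_const (c := (1 : ℂ)).congr fun z hz => ?_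
        obtain ⟨k, hk⟩ := hfint e i z hz hi
        simpa [φ, hk] using hexp k
  let v : ι → Additive (logClass K) := fun e => Additive.ofMul (toLogClass K (φ e))
  let F' : Set (Additive (logClass K)) := Additive.toMul ⁻¹' F
  have hv : ∀ e, v e ∈ Submodule.span ℤ F' := by
    intro e
    have h1 : toLogClass K (φ e) ∈ Subgroup.closure F := by
      obtain ⟨ψ, hψ, ρ, hρ, hψρ⟩ := Subgroup.mem_sup.1 (continuous_mem_sup hK (hφ e))
      rw [← hψρ, map_mul, toLogClass_eq_one.2 hψ, one_mul]
      have : factorGroup K ≤ (Subgroup.closure F).comap (toLogClass K) :=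
        (Subgroup.closure_le _).2 (range_subset_iff.2 hfac)
      exact this hρ
    rw [← Submodule.mem_toAddSubgroup, Submodule.span_int_eq_addSubgroupClosure,
      ← Subgroup.toAddSubgroup_closure]
    exact h1
  let D : ((Σ i, J i) → ℤ) →ₗ[ℤ] (ι → ℤ) :=
    LinearMap.funLeft ℤ ℤ (fun e : ι => ⟨e.1.2, κ _ ⟨x e, hxr e⟩⟩) -
      LinearMap.funLeft ℤ ℤ (fun e : ι => ⟨e.1.1, κ _ ⟨x e, hxl e⟩⟩)
  have main := card_le_of_ker_le_range (F := F') hF v hv D ?_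
  · rw [Fintype.card_sigma] at main
    exact main
  intro c hcker
  have hprod : (∏ e, φ e ^ c e) ∈ logGroup (univ : Set K) := by
    rw [← toLogClass_eq_one]
    rw [LinearMap.mem_ker, Fintype.linearCombination_apply] at hcker
    have : Additive.ofMul (toLogClass K (∏ e, φ e ^ c e)) = ∑ e, c e • v e := by
      rw [map_prod, ofMul_prod]
      simp [v]
    exact Additive.ofMul.injective (this.trans hcker)
  obtain ⟨g, hg, hge⟩ := hprod
  have hpi : (2 * Real.pi * Complex.I : ℂ) ≠ 0 := Complex.two_pi_I_ne_zero
  have hgsum : ∀ z : K, ∃ k : ℤ,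
      g z / (2 * Real.pi * Complex.I) - ∑ e, (c e : ℂ) * f e z = k := by
    intro z
    have h3 : Complex.exp (2 * Real.pi * Complex.I * ∑ e, (c e : ℂ) * f e z) =
        Complex.exp (g z) := by
      rw [← hge z trivial, Finset.mul_sum, Complex.exp_sum, Finset.prod_apply, Units.coe_prod]
      refine Finset.prod_congr rfl fun e _ => ?_
      simp only [φ, Pi.pow_apply, Units.val_zpow_eq_zpow_val, Units.val_mk0]
      rw [← Complex.exp_int_mul]
      congr 1; ring
    obtain ⟨k, hk⟩ := Complex.exp_eq_exp_iff_exists_int.1 h3.symm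
    refine ⟨k, ?_⟩
    rw [hk]; field_simp; ring
  let ext : ℂ → ℂ := fun z => if hz : z ∈ K then g ⟨z, hz⟩ else 0
  let G : Fin n → ℂ → ℂ := fun i z => ext z / (2 * Real.pi * Complex.I) -
    ∑ e ∈ Finset.univ.filter (fun e : ι => e.1.1 = i), (c e : ℂ) * h e z
  have hsub : ∀ i, X i ⊆ K := fun i => hXK ▸ subset_iUnion X i
  have hextc : ContinuousOn ext K := by
    rw [continuousOn_iff_continuous_domRestrict]
    convert continuousOn_univ.1 hg using 1
    ext z
    simp [ext]
  have hGc : ∀ i, ContinuousOn (G i) (X i) := by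
    intro i
    refine ((hextc.mono (hsub i)).div_const _).sub (Continuous.continuousOn ?_)
    have := hcont
    fun_prop
  have hGint : ∀ i, ∀ z ∈ X i, ∃ k : ℤ, G i z = k := by
    intro i z hz
    obtain ⟨k, hk⟩ := hgsum ⟨z, hsub i hz⟩
    have h3 : ∃ m : ℤ,
        ∑ e ∈ Finset.univ.filter (fun e : ι => ¬ e.1.1 = i), (c e : ℂ) * f e z = m := by
      choose! m hm using fun e (he : i ≠ e.1.1) => hfint e i z hz he
      refine ⟨∑ e ∈ Finset.univ.filter (fun e : ι => ¬ e.1.1 = i), c e * m e, ?_⟩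
      push_cast
      refine Finset.sum_congr rfl fun e he => ?_
      rw [hm e (Ne.symm (Finset.mem_filter.1 he).2)]
      simp
    obtain ⟨m, hm⟩ := h3
    have h4 : ∑ e ∈ Finset.univ.filter (fun e : ι => e.1.1 = i), (c e : ℂ) * h e z =
        ∑ e ∈ Finset.univ.filter (fun e : ι => e.1.1 = i), (c e : ℂ) * f e z := by
      refine Finset.sum_congr rfl fun e he => ?_
      have : z ∈ X e.1.1 := (Finset.mem_filter.1 he).2 ▸ hz
      simp [f, this]
    refine ⟨k + m, ?_⟩
    rw [← Finset.sum_filter_add_sum_filter_not _ (fun e : ι => e.1.1 = i), hm] at hk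
    simp only [G, ext, dif_pos (hsub i hz), h4]
    push_cast
    linear_combination hk
  have hconst : ∀ i (y y' : X i), κ i y = κ i y' → round (G i y).re = round (G i y').re := by
    intro i y y' hy
    obtain ⟨S, hS, hSp, hyS, hyS'⟩ := hκ i y y' hy
    exact hSp.constant (continuousOn_round_re ((hGc i).mono hS) fun z hz => hGint i z (hS hz))
      hyS hyS'
  let β : (Σ i, J i) → ℤ := fun s =>
    if hs : ∃ y : X s.1, κ s.1 y = s.2 then round (G s.1 hs.choose).re else 0
  have hβ : ∀ i (y : X i), (β ⟨i, κ i y⟩ : ℂ) = G i y := by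
    intro i y
    have hs : ∃ y' : X i, κ i y' = κ i y := ⟨y, rfl⟩
    obtain ⟨k, hk⟩ := hGint i y y.2
    have h5 : β ⟨i, κ i y⟩ = round (G i y).re := by
      simp only [β, dif_pos hs]
      exact hconst i _ _ hs.choose_spec
    rw [h5, hk]; simp
  refine ⟨β, funext fun e => ?_⟩
  have h6 : ((D β e : ℤ) : ℂ) = G e.1.2 (x e) - G e.1.1 (x e) := by
    simp only [D, LinearMap.sub_apply, Pi.sub_apply, LinearMap.funLeft_apply]
    push_cast
    rw [hβ, hβ]
  have h7 : ∑ e' ∈ Finset.univ.filter (fun e' : ι => e'.1.1 = e.1.1), (c e' : ℂ) * h e' (x e) =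
      c e := by
    rw [Finset.sum_eq_single_of_mem e (by simp)]
    · simp [hone e (x e) (hxl e) (hxr e)]
    · intro e' he' hne
      have h8 : e'.1.1 = e.1.1 := (Finset.mem_filter.1 he').2
      have h9 : e.1.2 ≠ e'.1.2 := fun h => hne (Subtype.ext (Prod.ext h8 h.symm))
      simp [hzero e' e.1.2 (h8 ▸ e.2.1.ne') h9 (x e) (h8 ▸ hxl e) (hxr e)]
  have h10 : ∑ e' ∈ Finset.univ.filter (fun e' : ι => e'.1.1 = e.1.2), (c e' : ℂ) * h e' (x e) =
      0 := by
    refine Finset.sum_eq_zero fun e' he' => ?_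
    have h8 : e'.1.1 = e.1.2 := (Finset.mem_filter.1 he').2
    have h9 : e.1.1 < e'.1.1 := h8 ▸ e.2.1
    simp [hzero e' e.1.1 h9.ne (h9.trans e'.2.1).ne (x e) (h8 ▸ hxr e) (hxl e)]
  simp only [G, h7, h10] at h6
  have h11 : ((D β e : ℤ) : ℂ) = c e := by rw [h6]; ring
  exact_mod_cast h11

theorem exists_mem_norm_gt {S : Set (ℝ × ℝ)} (hS : ¬ IsBounded S) (R : ℝ) :
    ∃ y ∈ S, R < ‖Complex.equivRealProdCLM.symm y‖ := by
  by_contra! h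
  refine hS (((isBounded_iff_forall_norm_le.2 ⟨R, ?_⟩ :
    IsBounded (Complex.equivRealProdCLM.symm '' S)).image
      (Complex.equivRealProdCLM : ℂ →L[ℝ] ℝ × ℝ)).subset fun y hy => ?_)
  · rintro _ ⟨y, hy, rfl⟩
    exact h y hy
  · exact ⟨_, ⟨y, hy, rfl⟩, Complex.equivRealProdCLM.apply_symm_apply y⟩

/-- The intersecting pairs of a 2-fold packing number at most the holes of the union plus the
total number of components. -/
theorem card_intersecting_le_holes {n r : ℕ} {X : Fin n → Set (ℝ × ℝ)}
    (hX : ∀ i, IsCompact (X i))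
    (h2 : ∀ i j k : Fin n, i ≠ j → j ≠ k → i ≠ k → X i ∩ X j ∩ X k = ∅)
    (hr : ∀ i, (pcomps (X i)).Finite ∧ Nat.card (pcomps (X i)) ≤ r)
    (hh : (holesSet (⋃ i, X i)).Finite) :
    (Finset.univ.filter
      (fun p : Fin n × Fin n => p.1 < p.2 ∧ (X p.1 ∩ X p.2).Nonempty)).card ≤
      Nat.card (holesSet (⋃ i, X i)) + r * n := by
  let e := Complex.equivRealProdCLM
  let U := ⋃ i, X i
  let Y : Fin n → Set ℂ := fun i => e ⁻¹' X i
  let K : Set ℂ := e ⁻¹' U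
  have hY : ∀ i, IsCompact (Y i) := fun i => e.toHomeomorph.isCompact_preimage.2 (hX i)
  have hK : IsCompact K := e.toHomeomorph.isCompact_preimage.2 (isCompact_iUnion hX)
  obtain ⟨R, hR⟩ := isBounded_iff_forall_norm_le.1 hK.isBounded
  have hfin : ∀ i, Fintype (pcomps (X i)) := fun i => (hr i).1.fintype
  have hjoin : ∀ q q' : (Kᶜ : Set ℂ), JoinedIn Uᶜ (e q) (e q') →
      toLogClass K (linFactor q) = toLogClass K (linFactor q') := by
    intro q q' h
    refine linFactor_eq_of_joined hK ?_
    have h1 := h.map_continuousOn (f := e.symm) e.symm.continuous.continuousOn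
    have h3 : JoinedIn (Kᶜ : Set ℂ) (q : ℂ) q' := by
      rw [e.symm_apply_apply, e.symm_apply_apply] at h1
      refine h1.mono ?_
      rintro _ ⟨y, hy, rfl⟩
      simpa [K] using hy
    exact (joinedIn_iff_joined q.2 q'.2).1 h3
  let comp : (Kᶜ : Set ℂ) → Set (ℝ × ℝ) := fun q => {y | JoinedIn Uᶜ (e q) y}
  let F : Set (logClass K) := (fun q => toLogClass K (linFactor q)) '' {q | IsBounded (comp q)}
  have hself : ∀ q : (Kᶜ : Set ℂ), e q ∈ comp q := fun q => JoinedIn.refl q.2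
  have hcomp : ∀ q q' : (Kᶜ : Set ℂ), comp q = comp q' →
      toLogClass K (linFactor q) = toLogClass K (linFactor q') := fun q q' h =>
    hjoin q q' (by have := hself q'; rwa [← h] at this)
  let cls : Set (ℝ × ℝ) → logClass K := fun C =>
    if hC : ∃ q, comp q = C then toLogClass K (linFactor hC.choose) else 1
  have hF : F ⊆ cls '' holesSet U := by
    rintro _ ⟨q, hq, rfl⟩
    refine ⟨comp q, ⟨⟨e q, q.2, rfl⟩, hq⟩, ?_⟩
    have hC : ∃ q', comp q' = comp q := ⟨q, rfl⟩
    simp only [cls, dif_pos hC]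
    exact hcomp _ _ hC.choose_spec
  have hfac : ∀ q : (Kᶜ : Set ℂ), toLogClass K (linFactor q) ∈ Subgroup.closure F := by
    intro q
    by_cases hq : IsBounded (comp q)
    · exact Subgroup.subset_closure ⟨q, hq, rfl⟩
    · obtain ⟨y, hy, hyR⟩ := exists_mem_norm_gt hq R
      have hy' : JoinedIn Uᶜ (e q) y := hy
      let q' : (Kᶜ : Set ℂ) := ⟨e.symm y, by simpa [K] using hy'.target_mem⟩
      rw [hjoin q q' (by simpa [q'] using hy'), linFactor_eq_one_of_far hR hyR]
      exact one_mem _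
  have main := card_intersecting_le hY
    (fun i j k h₁ h₂ h₃ => by simp only [Y, ← preimage_inter, h2 i j k h₁ h₂ h₃, preimage_empty])
    (J := fun i => pcomps (X i)) (fun i z => ⟨{y | JoinedIn (X i) (e z) y}, e z, z.2, rfl⟩)
    (fun i x y hxy => ?_) (K := K) preimage_iUnion ((hh.image cls).subset hF) hfac
  · have hpairs : ∀ i j, (Y i ∩ Y j).Nonempty ↔ (X i ∩ X j).Nonempty := fun i j => by
      rw [← preimage_inter, e.surjective.nonempty_preimage]
    simp only [hpairs] at main
    rw [Fintype.card_subtype] at main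
    refine main.trans (Nat.add_le_add ?_ ?_)
    · rw [Nat.card_coe_set_eq]
      exact (ncard_le_ncard hF (hh.image cls)).trans (ncard_image_le hh)
    · refine (Finset.sum_le_card_nsmul _ _ r fun i _ => ?_).trans (by simp [mul_comm])
      rw [← Nat.card_eq_fintype_card]
      exact (hr i).2
  · have h1 : JoinedIn (X i) (e x) (e y) := by
      have h2 : e y ∈ {w | JoinedIn (X i) (e y) w} := JoinedIn.refl y.2
      rwa [← (Subtype.mk.inj hxy : {w | JoinedIn (X i) (e x) w} = _)] at h2
    obtain ⟨γ, hγ⟩ := h1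
    refine ⟨e.symm '' range γ, ?_, (isPreconnected_range γ.continuous).image _
      e.symm.continuous.continuousOn, ⟨_, ⟨0, γ.source⟩, e.symm_apply_apply _⟩,
      ⟨_, ⟨1, γ.target⟩, e.symm_apply_apply _⟩⟩
    rintro _ ⟨_, ⟨t, rfl⟩, rfl⟩
    simpa [Y] using hγ t

/-- Lemma 4.1, base case k = 2: for f(n) = o(n²), r fixed and α > 0, only finitely
many n admit a 2-fold packing of n compact planar sets, each with at most r
arc-connected components, with at least α·C(n,2) intersecting pairs and at most f(n)
holes in the union. -/
theorem base_case_two_fold (f : ℕ → ℕ)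
    (hf : ∀ ε : ℝ, 0 < ε → ∃ N : ℕ, ∀ n ≥ N, (f n : ℝ) ≤ ε * (n : ℝ) ^ 2)
    (r : ℕ) (α : ℝ) (hα : 0 < α) :
    ∃ M : ℕ, ∀ n : ℕ, ∀ X : Fin n → Set (ℝ × ℝ),
      (∀ i, IsCompact (X i)) →
      (∀ i j k : Fin n, i ≠ j → j ≠ k → i ≠ k → X i ∩ X j ∩ X k = ∅) →
      (∀ i, (pcomps (X i)).Finite ∧ Nat.card (pcomps (X i)) ≤ r) →
      (α * ((n.choose 2 : ℕ) : ℝ) ≤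
        ((Finset.univ.filter
          (fun p : Fin n × Fin n => p.1 < p.2 ∧ (X p.1 ∩ X p.2).Nonempty)).card : ℝ)) →
      ((holesSet (⋃ i, X i)).Finite ∧ Nat.card (holesSet (⋃ i, X i)) ≤ f n) →
      n < M := by
  obtain ⟨N, hN⟩ := hf (α / 8) (by positivity)
  obtain ⟨M, hM⟩ := exists_nat_gt (8 * (r + α) / (3 * α))
  refine ⟨max N M, fun n X hX h2 hr hα' hh => ?_⟩
  by_contra! hn
  have h1 := card_intersecting_le_holes hX h2 hr hh.1
  have h3 : ((Finset.univ.filter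
      (fun p : Fin n × Fin n => p.1 < p.2 ∧ (X p.1 ∩ X p.2).Nonempty)).card : ℝ) ≤
      f n + r * n := by
    exact_mod_cast h1.trans (Nat.add_le_add_right hh.2 _)
  have h4 := hN n ((le_max_left _ _).trans hn)
  have h5 : (M : ℝ) ≤ n := by exact_mod_cast (le_max_right _ _).trans hn
  have h6 : 8 * (r + α) < 3 * α * n := by
    rw [mul_comm (3 * α)]
    exact (div_lt_iff₀ (by positivity)).1 (hM.trans_le h5)
  have hn0 : (0 : ℝ) < n := by
    by_contra! h
    nlinarith [(Nat.cast_nonneg r : (0 : ℝ) ≤ r)]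
  rw [Nat.cast_choose_two] at hα'
  nlinarith [mul_lt_mul_of_pos_right h6 hn0, mul_pos hα hn0,
    mul_nonneg (Nat.cast_nonneg r : (0 : ℝ) ≤ r) hn0.le]
end
end

section
/- Let ℓ be a positive integer with (ℓ−1)² > f(2ℓ) for a given function f : ℕ → ℕ. Suppose X₁,…,X_ℓ, Y₁,…,Y_ℓ are 2ℓ simply connected compact sets in the plane forming a 2-fold packing (no point is in three of them), such that the Xᵢ are pairwise disjoint, the Yⱼ are pairwise disjoint, and Xᵢ ∩ Yⱼ ≠ ∅ for all i, j. Then the union of all 2ℓ sets has more than f(2ℓ) holes. -/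
open Set Bornology Classical

noncomputable section

open Topology Metric

/-- `f` has a continuous logarithm on `K`. -/
def HasLogOn (K : Set ℂ) (f : ℂ → ℂ) : Prop :=
  ∃ g : ℂ → ℂ, ContinuousOn g K ∧ ∀ z ∈ K, f z = Complex.exp (g z)

namespace HasLogOn

variable {K : Set ℂ} {f g : ℂ → ℂ}

lemma congr (hf : HasLogOn K f) (h : ∀ z ∈ K, g z = f z) : HasLogOn K g := by
  obtain ⟨u, hu, hfu⟩ := hf
  exact ⟨u, hu, fun z hz => (h z hz).trans (hfu z hz)⟩

lemma mul (hf : HasLogOn K f) (hg : HasLogOn K g) : HasLogOn K (fun z => f z * g z) := by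
  obtain ⟨u, hu, hfu⟩ := hf
  obtain ⟨v, hv, hgv⟩ := hg
  exact ⟨fun z => u z + v z, hu.add hv, fun z hz => by
    simp only [hfu z hz, hgv z hz, Complex.exp_add]⟩

lemma inv (hf : HasLogOn K f) : HasLogOn K (fun z => (f z)⁻¹) := by
  obtain ⟨u, hu, hfu⟩ := hf
  exact ⟨fun z => -u z, hu.neg, fun z hz => by
    simp only [hfu z hz, Complex.exp_neg]⟩

lemma const {c : ℂ} (hc : c ≠ 0) : HasLogOn K (fun _ => c) :=
  ⟨fun _ => Complex.log c, continuousOn_const, fun _ _ => (Complex.exp_log hc).symm⟩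

lemma div_of_norm_sub_lt (hf : ContinuousOn f K) (hg : ContinuousOn g K)
    (h : ∀ z ∈ K, ‖f z - g z‖ < ‖g z‖) : HasLogOn K (fun z => f z / g z) := by
  have hg0 : ∀ z ∈ K, g z ≠ 0 := fun z hz => norm_pos_iff.1 ((norm_nonneg _).trans_lt (h z hz))
  have key : ∀ z ∈ K, f z / g z ∈ ball (1 : ℂ) 1 := fun z hz => by
    have : f z / g z - 1 = (f z - g z) / g z := by rw [sub_div, div_self (hg0 z hz)]
    rw [mem_ball, dist_eq_norm, this, norm_div, div_lt_one (norm_pos_iff.2 (hg0 z hz))]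
    exact h z hz
  have slit : ∀ z ∈ K, f z / g z ∈ Complex.slitPlane := fun z hz =>
    Complex.ball_one_subset_slitPlane (key z hz)
  exact ⟨fun z => Complex.log (f z / g z), (hf.div hg hg0).clog slit, fun z hz =>
    (Complex.exp_log (Complex.slitPlane_ne_zero (slit z hz))).symm⟩

lemma of_continuous_of_ne_zero {F : ℂ → ℂ} (hF : Continuous F) (h0 : ∀ z, F z ≠ 0) :
    HasLogOn univ F := by
  obtain ⟨G, ⟨-, hG⟩, -⟩ := Complex.isCoveringMap_exp.existsUnique_continuousMap_lifts
    (⟨fun z => ⟨F z, h0 z⟩, by fun_prop⟩ : C(ℂ, {z : ℂ // z ≠ 0})) 0 (Complex.log (F 0))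
    (Subtype.ext (Complex.exp_log (h0 0)))
  exact ⟨G, G.continuous.continuousOn, fun z _ => (congrArg Subtype.val (congrFun hG z)).symm⟩

lemma mono {L : Set ℂ} (hf : HasLogOn L f) (h : K ⊆ L) : HasLogOn K f := by
  obtain ⟨u, hu, hfu⟩ := hf
  exact ⟨u, hu.mono h, fun z hz => hfu z (h hz)⟩

/-- The radial retraction onto a closed disc reduces this to the case of the plane. -/
lemma of_ne_zero_on_closedBall {F : ℂ → ℂ} {R : ℝ} (hR : 0 < R) (hF : Continuous F)
    (h0 : ∀ z ∈ closedBall (0 : ℂ) R, F z ≠ 0) : HasLogOn (closedBall 0 R) F := by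
  let ρ : ℂ → ℂ := fun z => (R / max R ‖z‖ : ℝ) * z
  have hm : ∀ z : ℂ, 0 < max R ‖z‖ := fun z => lt_max_of_lt_left hR
  have hρc : Continuous ρ := by
    refine Continuous.mul (Complex.continuous_ofReal.comp ?_) continuous_id
    exact continuous_const.div (by fun_prop) fun z => (hm z).ne'
  have hρ : ∀ z, ρ z ∈ closedBall (0 : ℂ) R := fun z => by
    rw [mem_closedBall_zero_iff, norm_mul, Complex.norm_real, Real.norm_of_nonneg
      (div_nonneg hR.le (hm z).le), div_mul_eq_mul_div, div_le_iff₀ (hm z)]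
    exact mul_le_mul_of_nonneg_left (le_max_right _ _) hR.le
  refine ((of_continuous_of_ne_zero (hF.comp hρc) fun z => h0 _ (hρ z)).mono
    (subset_univ _)).congr fun z hz => ?_
  rw [mem_closedBall_zero_iff] at hz
  have : (R : ℂ) ≠ 0 := Complex.ofReal_ne_zero.2 hR.ne'
  simp [ρ, max_eq_left hz, div_self this]

lemma sub_div_sub_of_joinedIn (hK : IsCompact K) {p q : ℂ} (h : JoinedIn Kᶜ p q) :
    HasLogOn K (fun z => (z - p) / (z - q)) := by
  have hne : ∀ {y z : ℂ}, y ∈ Kᶜ → z ∈ K → z - y ≠ 0 := fun hy hz h0 =>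
    hy (sub_eq_zero.1 h0 ▸ hz)
  obtain ⟨γ, hγ⟩ := h
  have hpre : IsPreconnected (range γ) := isPreconnected_range γ.continuous
  have hsub : range γ ⊆ Kᶜ := by rintro _ ⟨t, rfl⟩; exact hγ t
  refine hpre.induction₂ (fun p q => HasLogOn K (fun z => (z - p) / (z - q))) (fun x hx => ?_)
    (fun x y z hx hy hz hxy hyz => ?_) (fun x y hx hy hxy => ?_) ⟨0, γ.source⟩ ⟨1, γ.target⟩
  · obtain ⟨ε, hε, hball⟩ := Metric.isOpen_iff.1 hK.isClosed.isOpen_compl x (hsub hx)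
    refine nhdsWithin_le_nhds ?_
    filter_upwards [ball_mem_nhds x (half_pos hε)] with y hy
    refine div_of_norm_sub_lt (by fun_prop) (by fun_prop) fun z hz => ?_
    have hxz : ε ≤ dist z x := not_lt.1 fun h => hball h hz
    have h1 := dist_triangle z y x
    rw [mem_ball] at hy
    rw [sub_sub_sub_cancel_left, ← dist_eq_norm, ← dist_eq_norm]
    linarith
  · refine (hxy.mul hyz).congr fun w hw => ?_
    have := hne (hsub hy) hw
    have := hne (hsub hz) hw
    field_simp
  · exact hxy.inv.congr fun w hw => by rw [inv_div]

lemma sub_of_large {q : ℂ} (h : ∀ z ∈ K, ‖z‖ < ‖q‖) : HasLogOn K (fun z => z - q) := by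
  rcases K.eq_empty_or_nonempty with rfl | ⟨z₀, hz₀⟩
  · exact ⟨0, continuousOn_empty _, fun z hz => hz.elim⟩
  have hq : -q ≠ 0 := neg_ne_zero.2 (norm_pos_iff.1 ((norm_nonneg _).trans_lt (h z₀ hz₀)))
  refine ((div_of_norm_sub_lt (f := fun z => z - q) (g := fun _ => -q) (by fun_prop)
    (by fun_prop) fun z hz => ?_).mul (const hq)).congr fun z hz => ?_
  · simpa using h z hz
  · rw [div_mul_cancel₀ _ hq]

lemma norm_sq_sub {q : ℂ} (hq : q ∉ K) :
    HasLogOn K (fun z => (z - q) * (starRingEnd ℂ) (z - q)) := by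
  have hne : ∀ z ∈ K, Complex.normSq (z - q) ≠ 0 := fun z hz h0 =>
    hq (sub_eq_zero.1 (Complex.normSq_eq_zero.1 h0) ▸ hz)
  refine ⟨fun z => (Real.log (Complex.normSq (z - q)) : ℂ), ?_, fun z hz => ?_⟩
  · exact Complex.continuous_ofReal.comp_continuousOn
      ((Complex.continuous_normSq.comp (by fun_prop)).continuousOn.log hne)
  · rw [← Complex.ofReal_exp, Real.exp_log ((Complex.normSq_nonneg _).lt_of_ne' (hne z hz)),
      ← Complex.mul_conj]

end HasLogOn

/-- On `K`, the function `f` agrees with a product of integer powers of the functions `z - p h`,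
up to a factor having a continuous logarithm. -/
def IsProdPowOn {H : Type*} [Fintype H] (K : Set ℂ) (p : H → ℂ) (f : ℂ → ℂ) : Prop :=
  ∃ m : H → ℤ, HasLogOn K (fun z => f z / ∏ h, (z - p h) ^ m h)

namespace IsProdPowOn

variable {H : Type*} [Fintype H] {K : Set ℂ} {p : H → ℂ} {f g : ℂ → ℂ}

lemma prod_ne_zero (hp : ∀ h, p h ∉ K) {z : ℂ} (hz : z ∈ K) (m : H → ℤ) :
    ∏ h, (z - p h) ^ m h ≠ 0 :=
  Finset.prod_ne_zero_iff.2 fun h _ => zpow_ne_zero _ (sub_ne_zero.2 fun e => hp h (e ▸ hz))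

lemma congr (hf : IsProdPowOn K p f) (h : ∀ z ∈ K, g z = f z) : IsProdPowOn K p g := by
  obtain ⟨m, hm⟩ := hf
  exact ⟨m, hm.congr fun z hz => by rw [h z hz]⟩

lemma of_hasLogOn (hf : HasLogOn K f) : IsProdPowOn K p f :=
  ⟨0, hf.congr fun z _ => by simp⟩

lemma mul (hp : ∀ h, p h ∉ K) (hf : IsProdPowOn K p f) (hg : IsProdPowOn K p g) :
    IsProdPowOn K p (fun z => f z * g z) := by
  obtain ⟨m, hm⟩ := hf
  obtain ⟨n, hn⟩ := hg
  refine ⟨m + n, (hm.mul hn).congr fun z hz => ?_⟩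
  have : ∏ h, (z - p h) ^ (m + n) h = (∏ h, (z - p h) ^ m h) * ∏ h, (z - p h) ^ n h := by
    rw [← Finset.prod_mul_distrib]
    exact Finset.prod_congr rfl fun h _ =>
      zpow_add₀ (sub_ne_zero.2 fun e : z = p h => hp h (e ▸ hz)) _ _
  rw [this, div_mul_div_comm]

lemma inv (hf : IsProdPowOn K p f) : IsProdPowOn K p (fun z => (f z)⁻¹) := by
  obtain ⟨m, hm⟩ := hf
  refine ⟨-m, hm.inv.congr fun z hz => ?_⟩
  simp [zpow_neg, Finset.prod_inv_distrib, div_eq_mul_inv, mul_comm]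

lemma sub (hK : IsCompact K) {q : ℂ}
    (hq : (∃ h, JoinedIn Kᶜ q (p h)) ∨ ∀ R : ℝ, ∃ q', R < ‖q'‖ ∧ JoinedIn Kᶜ q q') :
    IsProdPowOn K p (fun z => z - q) := by
  rcases hq with ⟨h, hj⟩ | hub
  · refine ⟨Pi.single h 1, (HasLogOn.sub_div_sub_of_joinedIn hK hj).congr fun z _ => ?_⟩
    congr 1
    rw [Finset.prod_eq_single h (fun b _ hb => by simp [hb]) (by simp)]
    simp
  · obtain ⟨R, hR⟩ := hK.isBounded.exists_norm_le
    obtain ⟨q', hRq, hj⟩ := hub R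
    refine of_hasLogOn (((HasLogOn.sub_div_sub_of_joinedIn hK hj).mul
      (HasLogOn.sub_of_large fun z hz => (hR z hz).trans_lt hRq)).congr fun z hz => ?_)
    rw [div_mul_cancel₀]
    exact sub_ne_zero.2 fun e => hj.target_mem (e ▸ hz)

lemma conj_sub (hp : ∀ h, p h ∉ K) {q : ℂ} (hqK : q ∉ K)
    (hq : IsProdPowOn K p (fun z => z - q)) :
    IsProdPowOn K p (fun z => (starRingEnd ℂ) (z - q)) := by
  refine (mul hp (of_hasLogOn (HasLogOn.norm_sq_sub hqK)) hq.inv).congr fun z hz => ?_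
  have : z - q ≠ 0 := sub_ne_zero.2 fun e => hqK (e ▸ hz)
  field_simp

end IsProdPowOn

/-- An invertible real-linear map of `ℂ` is close to a multiple of the identity or of the
conjugation. -/
lemma exists_norm_sub_mul_le (L : ℂ →L[ℝ] ℂ) (hL : ∀ w, L w = 0 → w = 0) :
    ∃ (e : ℂ →L[ℝ] ℂ) (c : ℂ) (κ : ℝ), ((∀ w, e w = w) ∨ ∀ w, e w = (starRingEnd ℂ) w) ∧
      κ < ‖c‖ ∧ ∀ w, ‖L w - c * e w‖ ≤ κ * ‖w‖ := by
  set α : ℂ := (L 1 - Complex.I * L Complex.I) / 2 with hα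
  set β : ℂ := (L 1 + Complex.I * L Complex.I) / 2 with hβ
  have hLw : ∀ w, L w = α * w + β * (starRingEnd ℂ) w := fun w => by
    have h1 : L w = w.re * L 1 + w.im * L Complex.I := by
      conv_lhs => rw [show w = w.re • (1 : ℂ) + w.im • Complex.I by
        simp [Complex.re_add_im]]
      rw [map_add, map_smul, map_smul, Complex.real_smul, Complex.real_smul]
    have h2 : (starRingEnd ℂ) w = w.re - w.im * Complex.I := by
      apply Complex.ext <;> simp
    rw [h1, h2]
    conv_rhs => rw [← Complex.re_add_im w]
    simp only [hα, hβ, Complex.add_re, Complex.ofReal_re, Complex.mul_re, Complex.I_re,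
      Complex.ofReal_im, Complex.I_im, Complex.add_im, Complex.mul_im, mul_zero, mul_one,
      sub_self, add_zero, zero_add]
    linear_combination ((w.im : ℂ) * L Complex.I) * Complex.I_mul_I
  rcases lt_trichotomy ‖β‖ ‖α‖ with h | h | h
  · refine ⟨ContinuousLinearMap.id ℝ ℂ, α, ‖β‖, Or.inl fun w => rfl, h, fun w => ?_⟩
    simp [hLw]
  · exfalso
    have hsq : α * (starRingEnd ℂ) α = β * (starRingEnd ℂ) β := by
      rw [Complex.mul_conj, Complex.mul_conj, Complex.normSq_eq_norm_sq,
        Complex.normSq_eq_norm_sq, h]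
    have e1 := hL ((starRingEnd ℂ) α - β) (by
      rw [hLw, map_sub, Complex.conj_conj]; linear_combination hsq)
    have e2 := hL (Complex.I * ((starRingEnd ℂ) α + β)) (by
      rw [hLw, map_mul, map_add, Complex.conj_conj, Complex.conj_I]
      linear_combination Complex.I * hsq)
    have e3 := (mul_eq_zero.1 e2).resolve_left Complex.I_ne_zero
    have b0 : β = 0 := by linear_combination (e3 - e1) / 2
    have a0 : α = 0 := by rw [← norm_eq_zero, ← h, b0, norm_zero]
    exact one_ne_zero (hL 1 (by rw [hLw, a0, b0]; simp))
  · refine ⟨Complex.conjCLE, β, ‖α‖, Or.inr fun w => by simp, h, fun w => ?_⟩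
    simp [hLw]

lemma HasFDerivAt.eventually_norm_div_sub_lt {F : ℂ → ℂ} {L e : ℂ →L[ℝ] ℂ} {q c : ℂ} {κ : ℝ}
    (hF : HasFDerivAt F L q) (hq : F q = 0) (he : ∀ w, ‖e w‖ = ‖w‖) (hκ : κ < ‖c‖)
    (h : ∀ w, ‖L w - c * e w‖ ≤ κ * ‖w‖) :
    ∀ᶠ z in 𝓝 q, z ≠ q → ‖F z / e (z - q) - c‖ < ‖c‖ := by
  have hδ : 0 < (‖c‖ - κ) / 2 := by linarith
  filter_upwards [hF.isLittleO.def hδ] with z hz hzq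
  rw [hq, sub_zero] at hz
  have hpos : 0 < ‖z - q‖ := norm_pos_iff.2 (sub_ne_zero.2 hzq)
  have he0 : e (z - q) ≠ 0 := norm_pos_iff.1 (by rwa [he])
  rw [div_sub' he0, norm_div, he, div_lt_iff₀ hpos, mul_comm _ c]
  have h1 := norm_add_le (F z - L (z - q)) (L (z - q) - c * e (z - q))
  rw [sub_add_sub_cancel] at h1
  nlinarith [h (z - q)]

/-- Dividing out a nondegenerate zero, modifying the function only near that zero. -/
lemma exists_remove_zero {F : ℂ → ℂ} {L : ℂ →L[ℝ] ℂ} {q : ℂ} (hFc : Continuous F)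
    (hF : HasFDerivAt F L q) (hq : F q = 0) (hL : ∀ w, L w = 0 → w = 0) {T : Set ℂ}
    (hT : IsClosed T) (hqT : q ∉ T) :
    ∃ (e : ℂ →L[ℝ] ℂ) (G : ℂ → ℂ), ((∀ w, e w = w) ∨ ∀ w, e w = (starRingEnd ℂ) w) ∧
      Continuous G ∧ (∀ᶠ z in 𝓝ˢ T, G z = F z / e (z - q)) ∧ G q ≠ 0 ∧
      ∀ z, G z = 0 → F z = 0 := by
  obtain ⟨e, c, κ, he, hκ, hLe⟩ := exists_norm_sub_mul_le L hL
  have hen : ∀ w, ‖e w‖ = ‖w‖ := fun w => by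
    rcases he with he | he <;> simp [he]
  have hc : 0 < ‖c‖ := by
    have := (norm_nonneg _).trans (hLe 1)
    rw [norm_one, mul_one] at this
    exact this.trans_lt hκ
  have he0 : ∀ z, z ≠ q → e (z - q) ≠ 0 := fun z hz => norm_pos_iff.1 (by
    rw [hen]; exact norm_pos_iff.2 (sub_ne_zero.2 hz))
  obtain ⟨r, hr, hball⟩ := Metric.eventually_nhds_iff_ball.1
    ((hF.eventually_norm_div_sub_lt hq hen hκ hLe).and (hT.isOpen_compl.mem_nhds hqT))
  have h32 : Disjoint (ball q (r / 2))ᶜ (closedBall q (r / 3)) := by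
    rw [disjoint_compl_left_iff_subset]
    exact closedBall_subset_ball (by linarith)
  obtain ⟨χ, hχ0, hχ1, hχ⟩ := exists_continuous_zero_one_of_isClosed
    isOpen_ball.isClosed_compl isClosed_closedBall h32
  have hχq : ∀ᶠ z in 𝓝 q, χ z = 1 := by
    filter_upwards [closedBall_mem_nhds q (show 0 < r / 3 by linarith)] with z hz
    exact hχ1 hz
  refine ⟨e, fun z => χ z * c + (1 - χ z) * (F z / e (z - q)), he, ?_, ?_, ?_, ?_⟩
  · refine continuous_iff_continuousAt.2 fun z => ?_
    by_cases hz : z = q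
    · subst hz
      refine (continuousAt_const (y := c)).congr ?_
      filter_upwards [hχq] with w hw
      simp [hw]
    · have h1 : ContinuousAt (fun z => F z / e (z - q)) z :=
        hFc.continuousAt.div (by fun_prop) (he0 z hz)
      have h2 : ContinuousAt (fun z => (χ z : ℂ)) z := by fun_prop
      exact (h2.mul continuousAt_const).add ((continuousAt_const.sub h2).mul h1)
  · refine Filter.eventually_of_mem (U := (closedBall q (r / 2))ᶜ) ?_ fun z hz => ?_
    · refine isClosed_closedBall.isOpen_compl.mem_nhdsSet.2 fun z hz hzq => ?_
      exact (hball z (closedBall_subset_ball (by linarith) hzq)).2 hz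
    · have : χ z = 0 := hχ0 fun h => hz (ball_subset_closedBall h)
      simp [this]
  · have : χ q = 1 := hχ1 (mem_closedBall_self (by linarith))
    simpa [this] using norm_pos_iff.1 hc
  · intro z hz
    by_cases hzr : z ∈ ball q r
    · by_cases hzq : z = q
      · rw [hzq, hq]
      exfalso
      have h1 := (hball z hzr).1 hzq
      have h2 : (χ z * c + (1 - χ z) * (F z / e (z - q)) : ℂ) - c =
        (1 - χ z : ℝ) * (F z / e (z - q) - c) := by push_cast; ring
      beta_reduce at hz
      rw [hz, zero_sub] at h2
      have h3 := congrArg norm h2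
      rw [norm_neg, norm_mul, Complex.norm_real,
        Real.norm_of_nonneg (sub_nonneg.2 (hχ z).2)] at h3
      nlinarith [(hχ z).1, (hχ z).2, norm_nonneg (F z / e (z - q) - c)]
    · have h0 : χ z = 0 := hχ0 fun h => hzr (ball_subset_ball (by linarith) h)
      have hzq : z ≠ q := fun h => hzr (h ▸ mem_ball_self hr)
      have h1 : F z / e (z - q) = 0 := by simpa only [h0, Complex.ofReal_zero, zero_mul,
        zero_add, sub_zero, one_mul] using hz
      exact (div_eq_zero_iff.1 h1).resolve_right (he0 z hzq)

lemma hasFDerivAt_div_comp_sub {F : ℂ → ℂ} {L e : ℂ →L[ℝ] ℂ} {q w : ℂ}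
    (hF : HasFDerivAt F L w) (hw : F w = 0) (he : e (w - q) ≠ 0) :
    HasFDerivAt (fun z => F z / e (z - q)) ((e (w - q))⁻¹ • L) w := by
  have h1 : DifferentiableAt ℝ (fun z => (e (z - q))⁻¹) w :=
    DifferentiableAt.inv (by fun_prop) he
  have h2 := hF.mul h1.hasFDerivAt
  simp only [hw, zero_smul, zero_add] at h2
  exact h2.congr_of_eventuallyEq (.of_forall fun z => div_eq_mul_inv _ _)

namespace IsProdPowOn

variable {H : Type*} [Fintype H] {K : Set ℂ} {p : H → ℂ}

lemma of_nondegenerate_zeros (hK : IsCompact K) (hp : ∀ h, p h ∉ K)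
    (hq : ∀ q ∉ K, (∃ h, JoinedIn Kᶜ q (p h)) ∨
      ∀ R : ℝ, ∃ q', R < ‖q'‖ ∧ JoinedIn Kᶜ q q')
    {R : ℝ} (hR : 0 < R) (hKR : K ⊆ closedBall 0 R) (Z : Finset ℂ) :
    ∀ F : ℂ → ℂ, Continuous F → (∀ z ∈ K, F z ≠ 0) →
      (∀ z ∈ closedBall (0 : ℂ) R, F z = 0 → z ∈ Z) →
      (∀ z ∈ Z, F z = 0 ∧ ∃ L : ℂ →L[ℝ] ℂ, HasFDerivAt F L z ∧ ∀ w, L w = 0 → w = 0) →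
      IsProdPowOn K p F := by
  induction Z using Finset.induction_on with
  | empty =>
    intro F hF _ hZ _
    exact of_hasLogOn ((HasLogOn.of_ne_zero_on_closedBall hR hF fun z hz h0 =>
      by simpa using hZ z hz h0).mono hKR)
  | insert q Z hqZ ih =>
    intro F hF hFK hZ hnd
    obtain ⟨hFq, L, hFL, hL⟩ := hnd q (Finset.mem_insert_self q Z)
    have hqK : q ∉ K := fun h => hFK q h hFq
    have hne : ∀ z ∈ K ∪ Z, z ≠ q := by
      rintro z (hz | hz) rfl
      exacts [hqK hz, hqZ hz]
    obtain ⟨e, G, he, hG, hGT, hGq, hG0⟩ := exists_remove_zero hF hFL hFq hL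
      (hK.isClosed.union Z.finite_toSet.isClosed) fun h => hne q h rfl
    have he0 : ∀ z ∈ K ∪ Z, e (z - q) ≠ 0 := fun z hz => by
      have := sub_ne_zero.2 (hne z hz)
      rcases he with he | he
      · rwa [he]
      · rw [he]
        exact (map_ne_zero _).2 this
    have hGKZ : ∀ z ∈ K ∪ Z, G z = F z / e (z - q) := fun z hz => hGT.self_of_nhdsSet z hz
    have hGrep := ih G hG
      (fun z hz => by
        rw [hGKZ z (Or.inl hz)]
        exact div_ne_zero (hFK z hz) (he0 z (Or.inl hz)))
      (fun z hz h0 => (Finset.mem_insert.1 (hZ z hz (hG0 z h0))).resolve_left fun h =>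
        hGq (h ▸ h0))
      (fun z hz => by
        obtain ⟨hFz, M, hFM, hM⟩ := hnd z (Finset.mem_insert_of_mem hz)
        have hzT : z ∈ K ∪ Z := Or.inr hz
        refine ⟨by rw [hGKZ z hzT, hFz, zero_div], (e (z - q))⁻¹ • M,
          (hasFDerivAt_div_comp_sub hFM hFz (he0 z hzT)).congr_of_eventuallyEq ?_,
          fun w hw => hM w ?_⟩
        · exact Filter.Eventually.filter_mono (nhds_le_nhdsSet hzT) hGT
        · exact (smul_eq_zero.1 hw).resolve_left (inv_ne_zero (he0 z hzT)))
    have herep : IsProdPowOn K p (fun z => e (z - q)) := by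
      have := sub hK (hq q hqK)
      rcases he with he | he
      · exact this.congr fun z _ => he _
      · exact (conj_sub hp hqK this).congr fun z _ => he _
    refine (mul hp hGrep herep).congr fun z hz => ?_
    rw [hGKZ z (Or.inl hz), div_mul_cancel₀ _ (he0 z (Or.inl hz))]

lemma of_contDiff (hK : IsCompact K) (hp : ∀ h, p h ∉ K)
    (hq : ∀ q ∉ K, (∃ h, JoinedIn Kᶜ q (p h)) ∨
      ∀ R : ℝ, ∃ q', R < ‖q'‖ ∧ JoinedIn Kᶜ q q')
    {F : ℂ → ℂ} (hF : Differentiable ℝ F) (hFK : ∀ z ∈ K, F z ≠ 0)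
    (hdet : ∀ z, F z = 0 → (fderiv ℝ F z).det ≠ 0) : IsProdPowOn K p F := by
  obtain ⟨R, hR, hKR⟩ := hK.isBounded.subset_closedBall_lt 0 0
  have hinj : ∀ z, F z = 0 → (fderiv ℝ F z).ker = ⊥ := fun z hz => by
    by_contra h
    exact hdet z hz (LinearMap.det_eq_zero_iff_ker_ne_bot.2 h)
  have hfin : ({z | F z = 0} ∩ closedBall (0 : ℂ) R).Finite := by
    refine ((isCompact_closedBall _ _).inter_left
      (isClosed_eq hF.continuous continuous_const)).finite ?_
    refine isDiscrete_iff_nhdsNE.2 fun z hz => ?_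
    have := (hF z).hasFDerivAt.eventually_ne (c := 0)
      ((LinearMap.exists_antilipschitzWith _ (hinj z hz.1)).imp fun _ h => h.2)
    rw [Filter.inf_principal_eq_bot]
    filter_upwards [this] with w hw h using hw h.1
  refine of_nondegenerate_zeros hK hp hq hR hKR hfin.toFinset F hF.continuous hFK
    (fun z hz h0 => by simpa using ⟨h0, by simpa using hz⟩) fun z hz => ?_
  have h0 : F z = 0 := (hfin.mem_toFinset.1 hz).1
  exact ⟨h0, fderiv ℝ F z, (hF z).hasFDerivAt, fun w hw => by
    simpa [hinj z h0] using LinearMap.mem_ker.2 hw⟩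

/-- If every point off the compact set `K` can be joined off `K` to some `p h` or to points of
arbitrarily large norm, then every nowhere zero continuous function on `K` is a product of powers
of the `z - p h` up to an exponential. -/
theorem of_continuousOn (hK : IsCompact K) (hp : ∀ h, p h ∉ K)
    (hq : ∀ q ∉ K, (∃ h, JoinedIn Kᶜ q (p h)) ∨
      ∀ R : ℝ, ∃ q', R < ‖q'‖ ∧ JoinedIn Kᶜ q q')
    {f : ℂ → ℂ} (hf : ContinuousOn f K) (hf0 : ∀ z ∈ K, f z ≠ 0) : IsProdPowOn K p f := by
  obtain ⟨δ, hδ, hδf⟩ : ∃ δ > 0, ∀ z ∈ K, δ ≤ ‖f z‖ := by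
    rcases K.eq_empty_or_nonempty with rfl | hne
    · exact ⟨1, one_pos, fun z hz => hz.elim⟩
    · obtain ⟨z₀, hz₀, hmin⟩ := hK.exists_isMinOn hne hf.norm
      exact ⟨‖f z₀‖, norm_pos_iff.2 (hf0 z₀ hz₀), fun z hz => hmin hz⟩
  obtain ⟨f', hf'⟩ := ContinuousMap.exists_restrict_eq hK.isClosed ⟨K.domRestrict f, hf.domRestrict⟩
  have hff' : ∀ z ∈ K, f' z = f z := fun z hz => congrArg (fun u : C(K, ℂ) => u ⟨z, hz⟩) hf'
  obtain ⟨F, hF, hFf, -⟩ := f'.continuous.exists_contDiff_approx (ε := fun _ => δ / 2) 1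
    continuous_const fun _ => half_pos hδ
  have hFd : Differentiable ℝ F := hF.differentiable (by simp)
  have hsard : MeasureTheory.volume (F '' {z | (fderiv ℝ F z).det = 0}) = 0 :=
    MeasureTheory.addHaar_image_eq_zero_of_det_fderivWithin_eq_zero _
      (fun z _ => (hFd z).hasFDerivAt.hasFDerivWithinAt) fun z hz => hz
  obtain ⟨c, hc, hcF⟩ : ∃ c ∈ ball (0 : ℂ) (δ / 2), c ∉ F '' {z | (fderiv ℝ F z).det = 0} := by
    by_contra! h
    exact (measure_ball_pos MeasureTheory.volume (0 : ℂ) (half_pos hδ)).ne'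
      (MeasureTheory.measure_mono_null h hsard)
  rw [mem_ball_zero_iff] at hc
  have hclose : ∀ z ∈ K, ‖F z - c - f z‖ < ‖f z‖ := fun z hz => by
    have h1 := hFf z
    rw [dist_eq_norm, hff' z hz] at h1
    have h2 := norm_sub_le (F z - f z) c
    rw [sub_right_comm] at h2
    linarith [hδf z hz]
  have hrep : IsProdPowOn K p (fun z => F z - c) := by
    refine of_contDiff hK hp hq (hFd.sub_const c) (fun z hz h0 => ?_) fun z hz h0 => ?_
    · have := hclose z hz
      rw [h0, zero_sub, norm_neg] at this
      exact this.false
    · rw [fderiv_sub_const] at h0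
      exact hcF ⟨z, h0, sub_eq_zero.1 hz⟩
  refine (mul hp hrep (of_hasLogOn (HasLogOn.div_of_norm_sub_lt
    (f := fun z => F z - c) (hFd.continuous.sub continuous_const).continuousOn hf
    hclose).inv)).congr fun z hz => ?_
  have : F z - c ≠ 0 := fun h0 => by
    have := hclose z hz
    rw [h0, zero_sub, norm_neg] at this
    exact this.false
  field_simp

end IsProdPowOn

/-- A choice of a point in each hole of `K ⊆ ℝ²` yields, for each nowhere zero continuous function
on `K`, a factorization into an exponential and integer powers. -/
lemma exists_exp_mul_prod_zpow {K : Set (ℝ × ℝ)} (hK : IsCompact K) [Fintype (holesSet K)] :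
    ∃ φ : (ℝ × ℝ) → holesSet K → ℂ, (∀ x ∈ K, ∀ h, φ x h ≠ 0) ∧
      ∀ f : ℝ × ℝ → ℂ, ContinuousOn f K → (∀ x ∈ K, f x ≠ 0) →
        ∃ (m : holesSet K → ℤ) (g : ℝ × ℝ → ℂ), ContinuousOn g K ∧
          ∀ x ∈ K, f x = Complex.exp (g x) * ∏ h, φ x h ^ m h := by
  let e : ℂ ≃L[ℝ] ℝ × ℝ := Complex.equivRealProdCLM
  have hhole : ∀ C : holesSet K, ∃ x ∈ Kᶜ, (C : Set (ℝ × ℝ)) = {y | JoinedIn Kᶜ x y} :=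
    fun C => C.2.1
  choose c hcK hc using hhole
  let L : Set ℂ := e ⁻¹' K
  have hL : IsCompact L := e.toHomeomorph.isCompact_preimage.2 hK
  have heK : ∀ x ∈ K, e.symm x ∈ L := fun x hx => by simpa [L] using hx
  have hjoin : ∀ {x : ℂ} {y : ℝ × ℝ}, JoinedIn Kᶜ (e x) y → JoinedIn Lᶜ x (e.symm y) :=
    fun {x y} h => by
      have := h.map e.symm.continuous
      rw [e.symm_apply_apply] at this
      refine this.mono ?_
      rintro _ ⟨z, hz, rfl⟩
      simpa [L] using hz
  have hq : ∀ q ∉ L, (∃ h, JoinedIn Lᶜ q (e.symm (c h))) ∨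
      ∀ R : ℝ, ∃ q', R < ‖q'‖ ∧ JoinedIn Lᶜ q q' := by
    intro q hqL
    by_cases hb : IsBounded {y | JoinedIn Kᶜ (e q) y}
    · left
      let h : holesSet K := ⟨_, ⟨e q, hqL, rfl⟩, hb⟩
      have hmem : c h ∈ (h : Set (ℝ × ℝ)) := by
        rw [hc h]
        exact JoinedIn.refl (hcK h)
      exact ⟨h, hjoin hmem⟩
    · right
      intro R
      by_contra! hR
      refine hb (((isBounded_closedBall (x := (0 : ℂ)) (r := R)).image
        (e : ℂ →L[ℝ] ℝ × ℝ)).subset fun y hy => ?_)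
      refine ⟨e.symm y, ?_, by simp⟩
      rw [mem_closedBall_zero_iff]
      by_contra! hlt
      exact hR _ hlt (hjoin hy)
  have hp : ∀ h, e.symm (c h) ∉ L := fun h => by simpa [L] using hcK h
  refine ⟨fun x h => e.symm x - e.symm (c h), fun x hx h h0 => ?_, fun f hf hf0 => ?_⟩
  · exact hp h (sub_eq_zero.1 h0 ▸ heK x hx)
  · obtain ⟨m, g, hg, hfg⟩ := IsProdPowOn.of_continuousOn hL hp hq
      (f := f ∘ e) (hf.comp e.continuous.continuousOn fun x hx => hx) fun z hz => hf0 _ hz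
    refine ⟨m, g ∘ e.symm, hg.comp e.symm.continuous.continuousOn heK, fun x hx => ?_⟩
    have h1 := hfg _ (heK x hx)
    rw [div_eq_iff (IsProdPowOn.prod_ne_zero hp (heK x hx) m)] at h1
    simpa using h1

lemma IsPreconnected.exists_int_of_exp_eq_one {E : Type*} [TopologicalSpace E] {S : Set E}
    (hS : IsPreconnected S) {u : E → ℂ} (hu : ContinuousOn u S)
    (h : ∀ x ∈ S, Complex.exp (u x) = 1) :
    ∃ n : ℤ, ∀ x ∈ S, u x = n * (2 * Real.pi * Complex.I) := by
  rcases S.eq_empty_or_nonempty with rfl | ⟨x₀, hx₀⟩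
  · exact ⟨0, fun x hx => hx.elim⟩
  obtain ⟨n, hn⟩ := Complex.exp_eq_one_iff.1 (h x₀ hx₀)
  refine ⟨n, fun x hx => hn ▸ ?_⟩
  refine hS.induction₂ (fun x y => u x = u y) (fun x hx => ?_) (fun _ _ _ _ _ _ => Eq.trans)
    (fun _ _ _ _ => Eq.symm) hx hx₀
  filter_upwards [(hu x hx).eventually (ball_mem_nhds _ Real.two_pi_pos), self_mem_nhdsWithin]
    with y hy hyS
  obtain ⟨a, ha⟩ := Complex.exp_eq_one_iff.1 (h x hx)
  obtain ⟨b, hb⟩ := Complex.exp_eq_one_iff.1 (h y hyS)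
  have h2 : ‖(2 * Real.pi * Complex.I : ℂ)‖ = 2 * Real.pi := by
    simp [abs_of_pos Real.pi_pos]
  rw [dist_eq_norm, ha, hb, ← sub_mul, norm_mul, h2,
    mul_lt_iff_lt_one_left Real.two_pi_pos, ← Int.cast_sub, Complex.norm_intCast,
    ← Int.cast_abs] at hy
  have : |b - a| < 1 := by exact_mod_cast hy
  rw [ha, hb, sub_eq_zero.1 (Int.abs_lt_one_iff.1 this)]

/-- On a grid of sets `X i`, `Y j`, a function equal to `exp (2 * π * I * χ)` on the `X i` and to `1` on
the `Y j` has a continuous logarithm only if `χ` is of the form `d j - c i` on `X i ∩ Y j`. -/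
lemma exists_int_sub_of_exp_eq {E ι : Type*} [TopologicalSpace E] {X Y : ι → Set E}
    (hX : ∀ i, IsPreconnected (X i)) (hY : ∀ j, IsPreconnected (Y j))
    {χ : E → ℝ} (hχ : Continuous χ) {w : E → ℂ}
    (hw : ContinuousOn w ((⋃ i, X i) ∪ ⋃ j, Y j))
    (hwX : ∀ i, ∀ x ∈ X i, Complex.exp (w x) = Complex.exp (2 * Real.pi * Complex.I * χ x))
    (hwY : ∀ j, ∀ x ∈ Y j, Complex.exp (w x) = 1) :
    ∃ c d : ι → ℤ, ∀ i j, ∀ x ∈ X i ∩ Y j, χ x = d j - c i := by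
  have hc : ∀ i, ∃ n : ℤ, ∀ x ∈ X i,
      w x - 2 * Real.pi * Complex.I * χ x = n * (2 * Real.pi * Complex.I) := fun i => by
    refine (hX i).exists_int_of_exp_eq_one (u := fun x => w x - 2 * Real.pi * Complex.I * χ x)
      ?_ fun x hx => ?_
    · refine (hw.mono ((subset_iUnion X i).trans subset_union_left)).sub ?_
      fun_prop
    · rw [Complex.exp_sub, hwX i x hx, div_self (Complex.exp_ne_zero _)]
  have hd : ∀ j, ∃ n : ℤ, ∀ x ∈ Y j, w x = n * (2 * Real.pi * Complex.I) := fun j =>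
    (hY j).exists_int_of_exp_eq_one
      (hw.mono ((subset_iUnion Y j).trans subset_union_right)) (hwY j)
  choose c hc using hc
  choose d hd using hd
  refine ⟨c, d, fun i j x hx => ?_⟩
  have h1 := hc i x hx.1
  rw [hd j x hx.2] at h1
  have h2 : (2 * Real.pi * Complex.I : ℂ) * (χ x - (d j - c i)) = 0 := by
    linear_combination -h1
  have h3 := sub_eq_zero.1 ((mul_eq_zero.1 h2).resolve_left Complex.two_pi_I_ne_zero)
  exact_mod_cast h3

/-- Two families of `k + 1` disjoint continua, any two from different families intersecting, have
a union with at least `k ^ 2` holes. -/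
lemma sq_le_card_holesSet {k : ℕ} {X Y : Fin (k + 1) → Set (ℝ × ℝ)}
    (hXc : ∀ i, IsCompact (X i)) (hYc : ∀ j, IsCompact (Y j))
    (hX : ∀ i, IsPreconnected (X i)) (hY : ∀ j, IsPreconnected (Y j))
    (hXd : ∀ i i', i ≠ i' → Disjoint (X i) (X i')) (hYd : ∀ j j', j ≠ j' → Disjoint (Y j) (Y j'))
    (hXY : ∀ i j, (X i ∩ Y j).Nonempty) [Fintype (holesSet ((⋃ i, X i) ∪ ⋃ j, Y j))] :
    k ^ 2 ≤ Fintype.card (holesSet ((⋃ i, X i) ∪ ⋃ j, Y j)) := by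
  set A := ⋃ i, X i with hA
  set B := ⋃ j, Y j with hB
  have hAc : IsCompact A := isCompact_iUnion hXc
  have hBc : IsCompact B := isCompact_iUnion hYc
  obtain ⟨φ, hφ0, hφ⟩ := exists_exp_mul_prod_zpow (hAc.union hBc)
  have hcell : ∀ {a b i j x}, x ∈ X a ∩ Y b → x ∈ X i ∩ Y j → a = i ∧ b = j :=
    fun {a b i j x} h h' => by
      constructor
      · by_contra hne; exact (hXd _ _ hne).le_bot ⟨h.1, h'.1⟩
      · by_contra hne; exact (hYd _ _ hne).le_bot ⟨h.2, h'.2⟩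
  have hclosed : ∀ i j, IsClosed (X i ∩ Y j) := fun i j =>
    (hXc i).isClosed.inter (hYc j).isClosed
  have hbump : ∀ t : Fin k × Fin k, ∃ χ : C(ℝ × ℝ, ℝ), ∀ i j, ∀ x ∈ X i ∩ Y j,
      χ x = if i = t.1.castSucc ∧ j = t.2.castSucc then 1 else 0 := by
    intro t
    let S : Set (ℝ × ℝ) := ⋃ s : {s : Fin (k + 1) × Fin (k + 1) //
      ¬ (s.1 = t.1.castSucc ∧ s.2 = t.2.castSucc)}, X s.1.1 ∩ Y s.1.2
    have hS : IsClosed S := isClosed_iUnion_of_finite fun s => hclosed _ _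
    have hd : Disjoint S (X t.1.castSucc ∩ Y t.2.castSucc) := by
      rw [Set.disjoint_left]
      intro x hx hx'
      obtain ⟨s, hs⟩ := mem_iUnion.1 hx
      exact s.2 (hcell hs hx')
    obtain ⟨χ, hχ0, hχ1, -⟩ := exists_continuous_zero_one_of_isClosed hS (hclosed _ _) hd
    refine ⟨χ, fun i j x hx => ?_⟩
    split_ifs with h
    · exact hχ1 (h.1 ▸ h.2 ▸ hx)
    · exact hχ0 (mem_iUnion.2 ⟨⟨(i, j), h⟩, hx⟩)
  choose χ hχ using hbump
  let f : Fin k × Fin k → ℝ × ℝ → ℂ := fun t x =>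
    if x ∈ A then Complex.exp (2 * Real.pi * Complex.I * χ t x) else 1
  have hfA : ∀ t, ∀ x ∈ A, f t x = Complex.exp (2 * Real.pi * Complex.I * χ t x) :=
    fun t x hx => if_pos hx
  have hfB : ∀ t, ∀ x ∈ B, f t x = 1 := fun t x hx => by
    by_cases hxA : x ∈ A
    · obtain ⟨i, hi⟩ := mem_iUnion.1 hxA
      obtain ⟨j, hj⟩ := mem_iUnion.1 hx
      rw [hfA t x hxA, hχ t i j x ⟨hi, hj⟩]
      split_ifs <;> simp [Complex.exp_two_pi_mul_I]
    · exact if_neg hxA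
  have hfc : ∀ t, ContinuousOn (f t) (A ∪ B) := fun t => by
    refine ContinuousOn.union_of_isClosed ?_ ?_ hAc.isClosed hBc.isClosed
    · refine ContinuousOn.congr (f := fun x => Complex.exp (2 * Real.pi * Complex.I * χ t x))
        ?_ (hfA t)
      fun_prop
    · exact continuousOn_const.congr (hfB t)
  have hf0 : ∀ t, ∀ x ∈ A ∪ B, f t x ≠ 0 := fun t x _ => by
    simp only [f]
    split_ifs
    exacts [Complex.exp_ne_zero _, one_ne_zero]
  choose m g hg hfg using fun t => hφ (f t) (hfc t) (hf0 t)
  let Φ : (Fin k × Fin k → ℤ) →ₗ[ℤ] (holesSet (A ∪ B) → ℤ) :=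
    Fintype.linearCombination ℤ m
  have hΦ : Function.Injective Φ := by
    refine (injective_iff_map_eq_zero Φ).2 fun l hl => ?_
    have hl' : ∀ h, ∑ t, l t * m t h = 0 := fun h => by
      simpa [Φ, Fintype.linearCombination_apply] using congrFun hl h
    let w : ℝ × ℝ → ℂ := fun x => ∑ t, l t * g t x
    have hw : ContinuousOn w (A ∪ B) :=
      continuousOn_finsetSum _ fun t _ => continuousOn_const.mul (hg t)
    have hexp : ∀ x ∈ A ∪ B, Complex.exp (w x) = ∏ t, f t x ^ l t := fun x hx => by
      have hone : ∏ t, (∏ h, φ x h ^ m t h) ^ l t = 1 := by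
        simp_rw [← Finset.prod_zpow, ← zpow_mul]
        rw [Finset.prod_comm]
        refine Finset.prod_eq_one fun h _ => ?_
        have : ∀ s : Finset (Fin k × Fin k),
            ∏ t ∈ s, φ x h ^ (m t h * l t) = φ x h ^ ∑ t ∈ s, m t h * l t := fun s => by
          induction s using Finset.induction_on with
          | empty => simp
          | insert a s ha ih =>
            rw [Finset.prod_insert ha, Finset.sum_insert ha, ih, zpow_add₀ (hφ0 x hx h)]
        rw [this, ← zpow_zero (φ x h), ← hl' h]
        simp_rw [mul_comm]
      simp_rw [fun t => hfg t x hx, mul_zpow, Finset.prod_mul_distrib, hone, mul_one,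
        ← Complex.exp_int_mul, ← Complex.exp_sum, w]
    obtain ⟨c, d, hcd⟩ := exists_int_sub_of_exp_eq hX hY
      (χ := fun x => ∑ t, l t * χ t x) (by fun_prop) hw
      (fun i x hx => by
        have hxA : x ∈ A := mem_iUnion.2 ⟨i, hx⟩
        rw [hexp x (Or.inl hxA)]
        simp_rw [hfA _ x hxA, ← Complex.exp_int_mul, ← Complex.exp_sum]
        congr 1
        push_cast
        rw [Finset.mul_sum]
        exact Finset.sum_congr rfl fun t _ => by ring)
      (fun j x hx => by
        have hxB : x ∈ B := mem_iUnion.2 ⟨j, hx⟩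
        rw [hexp x (Or.inr hxB)]
        simp [hfB _ x hxB])
    have hval : ∀ i j, d j - c i =
        ∑ t, l t * if i = t.1.castSucc ∧ j = t.2.castSucc then 1 else 0 := fun i j => by
      obtain ⟨x, hx⟩ := hXY i j
      have h1 := hcd i j x hx
      simp_rw [hχ _ i j x hx] at h1
      exact_mod_cast h1.symm
    have hlastX : ∀ j, d j - c (Fin.last k) = 0 := fun j => by
      rw [hval]
      refine Finset.sum_eq_zero fun t _ => ?_
      rw [if_neg fun h => (Fin.castSucc_lt_last t.1).ne' h.1, mul_zero]
    have hlastY : ∀ i, d (Fin.last k) - c i = 0 := fun i => by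
      rw [hval]
      refine Finset.sum_eq_zero fun t _ => ?_
      rw [if_neg fun h => (Fin.castSucc_lt_last t.2).ne' h.2, mul_zero]
    funext t
    have h1 := hval t.1.castSucc t.2.castSucc
    rw [Finset.sum_eq_single t, if_pos ⟨rfl, rfl⟩, mul_one] at h1
    · have h2 := hlastX t.2.castSucc
      have h3 := hlastY t.1.castSucc
      have h4 := hlastX (Fin.last k)
      simp only [Pi.zero_apply]
      linarith
    · intro s _ hs
      rw [if_neg, mul_zero]
      rintro ⟨h, h'⟩
      exact hs (Prod.ext (Fin.castSucc_injective k h.symm) (Fin.castSucc_injective k h'.symm))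
    · simp
  have hrank := LinearMap.finrank_le_finrank_of_injective hΦ
  simpa [Module.finrank_fintype_fun_eq_card, sq] using hrank

/-- If (ℓ−1)² > f(2ℓ) and X₁,…,X_ℓ,Y₁,…,Y_ℓ are simply connected compact planar sets
forming a 2-fold packing, with the Xᵢ pairwise disjoint, the Yⱼ pairwise disjoint and
every Xᵢ meeting every Yⱼ, then the union of all 2ℓ sets has more than f(2ℓ) holes. -/
theorem Kll_many_holes (f : ℕ → ℕ) (ℓ : ℕ) (hℓ : 0 < ℓ)
    (hgap : f (2 * ℓ) < (ℓ - 1) ^ 2)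
    (X Y : Fin ℓ → Set (ℝ × ℝ))
    (hXc : ∀ i, IsCompact (X i)) (hYc : ∀ j, IsCompact (Y j))
    (hXs : ∀ i, SimplyConn (X i)) (hYs : ∀ j, SimplyConn (Y j))
    (hpack : ∀ A B C : Fin ℓ ⊕ Fin ℓ, A ≠ B → B ≠ C → A ≠ C →
      Sum.elim X Y A ∩ Sum.elim X Y B ∩ Sum.elim X Y C = ∅)
    (hXd : ∀ i i' : Fin ℓ, i ≠ i' → Disjoint (X i) (X i'))
    (hYd : ∀ j j' : Fin ℓ, j ≠ j' → Disjoint (Y j) (Y j'))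
    (hXY : ∀ i j, (X i ∩ Y j).Nonempty) :
    (holesSet ((⋃ i, X i) ∪ ⋃ j, Y j)).Infinite ∨
      f (2 * ℓ) < Nat.card (holesSet ((⋃ i, X i) ∪ ⋃ j, Y j)) := by
  obtain ⟨k, rfl⟩ : ∃ k, ℓ = k + 1 := ⟨ℓ - 1, by omega⟩
  refine or_iff_not_imp_left.2 fun hfin => ?_
  have : Fintype (holesSet ((⋃ i, X i) ∪ ⋃ j, Y j)) := (not_infinite.1 hfin).fintype
  rw [Nat.card_eq_fintype_card]
  exact hgap.trans_le (sq_le_card_holesSet hXc hYc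
    (fun i => (hXs i).1.isConnected.isPreconnected)
    (fun j => (hYs j).1.isConnected.isPreconnected) hXd hYd hXY)
end
end
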